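/- arXiv:1701.01978 — 2 statements merged into one kernel-verified Lean document; each statement's English description precedes it below -/
import Mathlib

section
/- Let π_L and π̃_L be uniformizers for L, with minimum polynomials over K given by f(X) = X^n − c_1X^{n−1} + ⋯ + (−1)^{n−1}c_{n−1}X + (−1)^n c_n and f̃(X) = X^n − c̃_1X^{n−1} + ⋯ + (−1)^{n−1}c̃_{n−1}X + (−1)^n c̃_n respectively. Suppose there exist an integer ℓ ≥ 1 and a K-automorphism σ of L such that σ(π̃_L) ≡ π_L (mod M_L^{ℓ+1}). Then for every h with 1 ≤ h ≤ n, one has c̃_h ≡ c_h (mod M_K^{ρ_h(ℓ)}). -/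
open scoped Classical

noncomputable section

/-- `v` is a normalized (surjective onto `ℤ`) additive discrete valuation on the field `F`. -/
structure IsDiscreteValuationOn {F : Type*} [Field F] (v : F → WithTop ℤ) : Prop where
  eq_top_iff : ∀ x : F, v x = ⊤ ↔ x = 0
  map_mul : ∀ x y : F, v (x * y) = v x + v y
  min_le_add : ∀ x y : F, min (v x) (v y) ≤ v (x + y)
  surjective : ∀ m : ℤ, ∃ x : F, v x = (m : WithTop ℤ)

/-- `F` is complete with respect to the additive valuation `v`: every Cauchy sequence
(with respect to `v`) converges. -/
def IsCompleteWrt {F : Type*} [Field F] (v : F → WithTop ℤ) : Prop :=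
  ∀ f : ℕ → F,
    (∀ N : ℤ, ∃ M : ℕ, ∀ i ≥ M, ∀ k ≥ M, (N : WithTop ℤ) ≤ v (f i - f k)) →
      ∃ a : F, ∀ N : ℤ, ∃ M : ℕ, ∀ i ≥ M, (N : WithTop ℤ) ≤ v (f i - a)

/-- The residue field of `v` is perfect of characteristic `p`: the rational prime `p`
lies in the maximal ideal, and modulo the maximal ideal every integral element is the
`p`-th power of an integral element. -/
def HasPerfectResidueFieldCharP {F : Type*} [Field F] (v : F → WithTop ℤ) (p : ℕ) : Prop :=
  (1 : WithTop ℤ) ≤ v (p : F) ∧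
    ∀ x : F, (0 : WithTop ℤ) ≤ v x →
      ∃ y : F, (0 : WithTop ℤ) ≤ v y ∧ (1 : WithTop ℤ) ≤ v (x - y ^ p)

/-- `v̄_p(k) = min(v_p(k), ν)`. -/
def vbar (p ν k : ℕ) : ℕ := min (padicValNat p k) ν

/-- The coefficient `c_h` of the minimal polynomial
`f(X) = X^n - c_1 X^{n-1} + ... + (-1)^{n-1} c_{n-1} X + (-1)^n c_n` of `π` over `K`,
where `n = [L:K]`; i.e. `c_h = (-1)^h · (coefficient of X^{n-h} in f)`. -/
def minpolyCoeff (K : Type*) {L : Type*} [Field K] [Field L] [Algebra K L]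
    (n : ℕ) (π : L) (h : ℕ) : K :=
  (-1) ^ h * (minpoly K π).coeff (n - h)

/-- `i_j^{π_L} = min { n·v_K(c_h) - h : 1 ≤ h ≤ n, v̄_p(h) ≤ j }` (an element of
`WithTop ℤ`, the `min` of the empty set being `⊤`). -/
def iPi {K : Type*} [Field K] (vK : K → WithTop ℤ) (p ν n : ℕ) (c : ℕ → K) (j : ℕ) :
    WithTop ℤ :=
  ((Finset.Icc 1 n).filter fun h => vbar p ν h ≤ j).inf
    fun h => (vK (c h)).map fun a => (n : ℤ) * a - (h : ℤ)

/-- The `j`-th index of inseparability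
`i_j = min { i_{j'}^{π_L} + (j' - j)·e_L : j ≤ j' ≤ ν }`, where `eL = v_L(p)`. -/
def insepIdx {K : Type*} [Field K] (vK : K → WithTop ℤ) (p ν n : ℕ) (eL : WithTop ℤ)
    (c : ℕ → K) (j : ℕ) : WithTop ℤ :=
  (Finset.Icc j ν).inf fun j' => iPi vK p ν n c j' + (j' - j) • eL

/-- `φ̃_j(x) = i_j + p^j·x`. -/
def phiTilde {K : Type*} [Field K] (vK : K → WithTop ℤ) (p ν n : ℕ) (eL : WithTop ℤ)
    (c : ℕ → K) (j x : ℕ) : WithTop ℤ :=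
  insepIdx vK p ν n eL c j + (((p ^ j * x : ℕ) : ℤ) : WithTop ℤ)

/-- `φ_j(x) = min { φ̃_{j₀}(x) : 0 ≤ j₀ ≤ j }`. -/
def phiIdx {K : Type*} [Field K] (vK : K → WithTop ℤ) (p ν n : ℕ) (eL : WithTop ℤ)
    (c : ℕ → K) (j x : ℕ) : WithTop ℤ :=
  (Finset.Icc 0 j).inf fun j0 => phiTilde vK p ν n eL c j0 x


set_option linter.unusedVariables false

section NCHelpers

lemma nc_cancel (x y : WithTop ℤ) (n : ℕ) : x + (n : WithTop ℤ) ≤ y + (n : WithTop ℤ) ↔ x ≤ y := by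
  have : ((n : WithTop ℤ)) = (((n : ℤ)) : WithTop ℤ) := by norm_cast
  rw [this]
  exact WithTop.add_le_add_iff_right (WithTop.coe_ne_top)

lemma nc_natCast (n : ℕ) : ((n : WithTop ℤ)) = (((n : ℤ)) : WithTop ℤ) := by norm_cast

lemma nc_nsmul (k q : ℕ) : k • ((q : ℕ) : WithTop ℤ) = ((k * q : ℕ) : WithTop ℤ) := by
  induction k with
  | zero => simp
  | succ k ih => rw [succ_nsmul, ih, ← Nat.cast_add]; congr 1; ring

/-- abstract version of the function `φ`. -/
def ncPhi (p m : ℕ) (I : ℕ → WithTop ℤ) (a : ℕ) : WithTop ℤ :=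
  (Finset.Icc 0 a).inf fun j => I j + ((p ^ j * m : ℕ) : WithTop ℤ)

lemma ncPhi_le (p m : ℕ) (I : ℕ → WithTop ℤ) {a b : ℕ} (hab : a ≤ b) :
    ncPhi p m I b ≤ I a + ((p ^ a * m : ℕ) : WithTop ℤ) :=
  Finset.inf_le (f := fun j => I j + ((p ^ j * m : ℕ) : WithTop ℤ)) (by simp [hab])

lemma ncPhi_anti (p m : ℕ) (I : ℕ → WithTop ℤ) {a b : ℕ} (hab : a ≤ b) :
    ncPhi p m I b ≤ ncPhi p m I a :=
  Finset.inf_mono (Finset.Icc_subset_Icc le_rfl hab)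

lemma ncPhi_exists (p m : ℕ) (I : ℕ → WithTop ℤ) (a : ℕ) :
    ∃ j ≤ a, ncPhi p m I a = I j + ((p ^ j * m : ℕ) : WithTop ℤ) := by
  obtain ⟨j, hj, h⟩ := Finset.exists_mem_eq_inf (Finset.Icc 0 a) ⟨0, by simp⟩
    (fun j => I j + ((p ^ j * m : ℕ) : WithTop ℤ))
  exact ⟨j, (Finset.mem_Icc.1 hj).2, h⟩

lemma nc_cast_le {a b : ℕ} (h : a ≤ b) : (a : WithTop ℤ) ≤ (b : WithTop ℤ) := by
  exact_mod_cast h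

lemma ncPhi_add (p m : ℕ) (hp : 0 < p) (I : ℕ → WithTop ℤ) (hI : ∀ a, 0 ≤ I a) {a b : ℕ}
    (hab : a ≤ b) : ncPhi p m I a ≤ ncPhi p m I b + I a := by
  obtain ⟨j, hj, h⟩ := ncPhi_exists p m I b
  rw [h]
  by_cases hja : j ≤ a
  · calc _ ≤ _ := ncPhi_le p m I hja
      _ ≤ _ := le_add_of_nonneg_right (hI a)
  · calc _ ≤ _ := ncPhi_le p m I le_rfl
      _ ≤ I a + ((p ^ j * m : ℕ) : WithTop ℤ) := by
          refine add_le_add le_rfl (nc_cast_le (Nat.mul_le_mul ?_ le_rfl))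
          exact Nat.pow_le_pow_right hp (by omega)
      _ = 0 + ((p ^ j * m : ℕ) : WithTop ℤ) + I a := by rw [zero_add, add_comm]
      _ ≤ _ := by gcongr; exact hI j

lemma ncPhi_smul (p m ν : ℕ) (hp : 0 < p) (I : ℕ → WithTop ℤ) (e : WithTop ℤ) (he : 0 ≤ e)
    (hI : ∀ a b, a ≤ b → b ≤ ν → I a ≤ I b + (b - a) • e) {a b : ℕ}
    (hab : a ≤ b) (hb : b ≤ ν) : ncPhi p m I a ≤ ncPhi p m I b + (b - a) • e := by
  obtain ⟨j, hj, h⟩ := ncPhi_exists p m I b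
  rw [h]
  by_cases hja : j ≤ a
  · calc _ ≤ _ := ncPhi_le p m I hja
      _ ≤ _ := le_add_of_nonneg_right (nsmul_nonneg he _)
  · calc _ ≤ _ := ncPhi_le p m I le_rfl
      _ ≤ (I j + (j - a) • e) + ((p ^ j * m : ℕ) : WithTop ℤ) := by
          refine add_le_add (hI a j (by omega) (by omega))
            (nc_cast_le (Nat.mul_le_mul ?_ le_rfl))
          exact Nat.pow_le_pow_right hp (by omega)
      _ = (I j + ((p ^ j * m : ℕ) : WithTop ℤ)) + (j - a) • e := by rw [add_right_comm]
      _ ≤ _ := by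
          refine add_le_add le_rfl (nsmul_le_nsmul_left he (by omega))

lemma nc_choose (p : ℕ) (hp : p.Prime) (a t k : ℕ) (hk : 1 ≤ k) (ht : p ^ a ∣ t) :
    p ^ (a - min a (padicValNat p k)) ∣ t.choose k := by
  have := Fact.mk hp
  by_cases hv : a ≤ padicValNat p k
  · simp [min_eq_left hv]
  rw [min_eq_right (by omega)]
  obtain ⟨k', hk'⟩ := pow_padicValNat_dvd (p := p) (n := k)
  set v := padicValNat p k with hvdef
  have hcop : ¬ p ∣ k' := by
    rintro ⟨x, rfl⟩
    have : p ^ (v + 1) ∣ k := ⟨x, by rw [pow_succ, mul_assoc]; exact hk'⟩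
    exact (pow_succ_padicValNat_not_dvd (p := p) (by omega)) this
  have h1 : p ^ a ∣ k * t.choose k := by
    rcases Nat.eq_zero_or_pos t with rfl | htp
    · rw [Nat.choose_eq_zero_of_lt (by omega)]; simp
    · obtain ⟨t', rfl⟩ : ∃ t', t = t' + 1 := ⟨t - 1, by omega⟩
      obtain ⟨q, rfl⟩ : ∃ q, k = q + 1 := ⟨k - 1, by omega⟩
      rw [mul_comm, ← Nat.add_one_mul_choose_eq]
      exact Dvd.dvd.mul_right ht _
  rw [hk'] at h1
  have h2 : p ^ a = p ^ v * p ^ (a - v) := by rw [← pow_add]; congr 1; omega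
  rw [← hk', h2] at h1
  have h3 : k * t.choose k = p ^ v * (k' * t.choose k) := by
    rw [← mul_assoc, ← hk']
  rw [h3] at h1
  have h4 := Nat.dvd_of_mul_dvd_mul_left (pow_pos hp.pos v) h1
  exact (Nat.Coprime.pow_left _ ((Nat.Prime.coprime_iff_not_dvd hp).2 hcop)).dvd_of_dvd_mul_left h4

lemma nc_nat_nonneg {L : Type*} [Field L] (V : AddValuation L (WithTop ℤ)) (c : ℕ) :
    0 ≤ V (c : L) := by
  induction c with
  | zero => simp
  | succ k ih => push_cast; exact V.map_le_add ih (by simp)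

lemma nc_pow_dvd {L : Type*} [Field L] (V : AddValuation L (WithTop ℤ)) (p c r : ℕ)
    (h : p ^ r ∣ c) : r • V (p : L) ≤ V (c : L) := by
  obtain ⟨d, rfl⟩ := h
  push_cast
  rw [V.map_mul, V.map_pow]
  exact le_add_of_nonneg_right (nc_nat_nonneg V d)

lemma nc_Vpow {L : Type*} [Field L] (V : AddValuation L (WithTop ℤ)) (π : L) (hπ : V π = 1)
    (t : ℕ) : V (π ^ t) = (t : WithTop ℤ) := by
  rw [V.map_pow, hπ, nsmul_one]

section
variable {K L : Type*} [Field K] [Field L] [Algebra K L]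

lemma nc_distinct (V : AddValuation L (WithTop ℤ)) (n : ℕ) (vK : K → WithTop ℤ)
    (htot : ∀ x : K, V (algebraMap K L x) = n • vK x)
    (ϖ ϖ' : L) (hϖ : V ϖ = 1) (hϖ' : V ϖ' = 1) (a b : K) (s t : ℕ) (hs : s < n) (ht : t < n)
    (heq : V (algebraMap K L a * ϖ ^ s) = V (algebraMap K L b * ϖ' ^ t))
    (htop : V (algebraMap K L a * ϖ ^ s) ≠ ⊤) : s = t := by
  have htop2 := heq ▸ htop
  rw [V.map_mul, nc_Vpow V _ hϖ, htot] at heq htop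
  rw [V.map_mul, nc_Vpow V _ hϖ', htot] at heq htop2
  rcases ha : vK a with _ | x
  · exfalso; apply htop; rw [ha]
    obtain ⟨n', rfl⟩ : ∃ n', n = n' + 1 := ⟨n - 1, by omega⟩
    change (n' + 1) • (⊤ : WithTop ℤ) + _ = ⊤
    rw [succ_nsmul]; simp
  rcases hb : vK b with _ | y
  · exfalso; apply htop2; rw [hb]
    obtain ⟨n', rfl⟩ : ∃ n', n = n' + 1 := ⟨n - 1, by omega⟩
    change (n' + 1) • (⊤ : WithTop ℤ) + _ = ⊤
    rw [succ_nsmul]; simp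
  rw [ha, hb, nc_natCast, nc_natCast] at heq
  have h1 : (n • x + (s : ℤ)) = n • y + (t : ℤ) := by
    have : ((n • x + (s : ℤ) : ℤ) : WithTop ℤ) = ((n • y + (t : ℤ) : ℤ) : WithTop ℤ) := heq
    exact_mod_cast this
  simp only [nsmul_eq_mul] at h1
  have h2 : ((s : ℤ)) % n = (t : ℤ) % n := by
    have := congrArg (· % (n : ℤ)) h1
    simpa using this
  rw [Int.emod_eq_of_lt (by omega) (by omega), Int.emod_eq_of_lt (by omega) (by omega)] at h2
  omega

lemma nc_sum (V : AddValuation L (WithTop ℤ)) (n : ℕ) (hn : 0 < n) (vK : K → WithTop ℤ)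
    (htot : ∀ x : K, V (algebraMap K L x) = n • vK x)
    (ϖ : L) (hϖ : V ϖ = 1) (a : ℕ → K) :
    ∃ t < n, V (∑ t ∈ Finset.range n, algebraMap K L (a t) * ϖ ^ t) =
        V (algebraMap K L (a t) * ϖ ^ t) ∧
      ∀ s < n, V (∑ t ∈ Finset.range n, algebraMap K L (a t) * ϖ ^ t) ≤
        V (algebraMap K L (a s) * ϖ ^ s) := by
  obtain ⟨t, ht, hmin⟩ := Finset.exists_min_image (Finset.range n)
    (fun t => V (algebraMap K L (a t) * ϖ ^ t)) ⟨0, by simpa using hn⟩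
  have ht' := Finset.mem_range.1 ht
  have key : V (∑ t ∈ Finset.range n, algebraMap K L (a t) * ϖ ^ t) =
        V (algebraMap K L (a t) * ϖ ^ t) := by
    by_cases htop : V (algebraMap K L (a t) * ϖ ^ t) = ⊤
    · rw [htop]
      refine top_le_iff.1 (V.map_le_sum fun s hs => ?_)
      have := hmin s hs
      rwa [htop] at this
    · rw [← Finset.add_sum_erase _ _ ht]
      refine V.map_add_eq_of_lt_left (V.map_lt_sum htop fun s hs => ?_)
      rw [Finset.mem_erase] at hs
      refine lt_of_le_of_ne (hmin s hs.2) fun h => hs.1 ?_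
      exact (nc_distinct V n vK htot ϖ ϖ hϖ hϖ _ _ t s ht' (Finset.mem_range.1 hs.2) h htop).symm
  refine ⟨t, ht', key, fun s hs => ?_⟩
  rw [key]
  exact hmin s (Finset.mem_range.2 hs)

/-- Every element is a combination of powers of a uniformizer. -/
lemma nc_repr [FiniteDimensional K L] (V : AddValuation L (WithTop ℤ)) (n : ℕ) (hn : 0 < n)
    (vK : K → WithTop ℤ) (hdim : Module.finrank K L = n)
    (htot : ∀ x : K, V (algebraMap K L x) = n • vK x)
    (ϖ : L) (hϖ : V ϖ = 1) :
    (∀ x : L, ∃ a : ℕ → K, x = ∑ t ∈ Finset.range n, algebraMap K L (a t) * ϖ ^ t) ∧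
    (∀ a : ℕ → K, ∑ t ∈ Finset.range n, algebraMap K L (a t) * ϖ ^ t = 0 → ∀ t < n, a t = 0) := by
  have h0 : ϖ ≠ 0 := by
    rintro rfl
    rw [V.map_zero] at hϖ
    exact absurd hϖ (by decide)
  have hind : ∀ a : ℕ → K, ∑ t ∈ Finset.range n, algebraMap K L (a t) * ϖ ^ t = 0 →
      ∀ t < n, a t = 0 := by
    intro a ha t ht
    obtain ⟨_, _, _, h⟩ := nc_sum V n hn vK htot ϖ hϖ a
    have := h t ht
    rw [ha, V.map_zero, top_le_iff, V.top_iff, mul_eq_zero] at this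
    rcases this with h | h
    · exact (map_eq_zero _).1 h
    · exact absurd h (pow_ne_zero _ h0)
  refine ⟨fun x => ?_, hind⟩
  have hli : LinearIndependent K (fun i : Fin n => ϖ ^ (i : ℕ)) := by
    rw [Fintype.linearIndependent_iff]
    intro g hg i
    have := hind (fun t => if ht : t < n then g ⟨t, ht⟩ else 0) ?_ i i.2
    · simpa using this
    · rw [Finset.sum_range, ← hg]
      refine Finset.sum_congr rfl fun i _ => ?_
      simp [Algebra.smul_def]
  have hspan := hli.span_eq_top_of_card_eq_finrank' (by simp [hdim])
  have hx : x ∈ Submodule.span K (Set.range (fun i : Fin n => ϖ ^ (i : ℕ))) := by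
    rw [hspan]; trivial
  rw [Submodule.mem_span_range_iff_exists_fun] at hx
  obtain ⟨g, hg⟩ := hx
  refine ⟨fun t => if ht : t < n then g ⟨t, ht⟩ else 0, ?_⟩
  rw [Finset.sum_range, ← hg]
  refine Finset.sum_congr rfl fun i _ => ?_
  simp [Algebra.smul_def]

lemma nc_minpoly [FiniteDimensional K L] (V : AddValuation L (WithTop ℤ)) (n : ℕ) (hn : 0 < n)
    (vK : K → WithTop ℤ) (hdim : Module.finrank K L = n)
    (htot : ∀ x : K, V (algebraMap K L x) = n • vK x)
    (ϖ : L) (hϖ : V ϖ = 1) :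
    ϖ ^ n = ∑ t ∈ Finset.range n, algebraMap K L (-(minpoly K ϖ).coeff t) * ϖ ^ t := by
  have hint : IsIntegral K ϖ := IsIntegral.of_finite K ϖ
  have hmon := minpoly.monic hint
  have hle : (minpoly K ϖ).natDegree ≤ n := hdim ▸ minpoly.natDegree_le ϖ
  have hz := minpoly.aeval K ϖ
  have hdeg : (minpoly K ϖ).natDegree = n := by
    by_contra hne
    have hlt : (minpoly K ϖ).natDegree < n := lt_of_le_of_ne hle hne
    rw [Polynomial.aeval_eq_sum_range' hlt] at hz
    have := (nc_repr V n hn vK hdim htot ϖ hϖ).2 (minpoly K ϖ).coeff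
      (by simpa [Algebra.smul_def] using hz) _ hlt
    rw [hmon.coeff_natDegree] at this
    exact one_ne_zero this
  rw [Polynomial.aeval_eq_sum_range, hdeg, Finset.sum_range_succ] at hz
  have h1 : (minpoly K ϖ).coeff n = 1 := by
    rw [← hdeg]; exact hmon.coeff_natDegree
  rw [h1, one_smul] at hz
  rw [eq_neg_of_add_eq_zero_right hz, ← Finset.sum_neg_distrib]
  refine Finset.sum_congr rfl fun t _ => ?_
  simp [Algebra.smul_def]

/-- The subgroup `W` of elements whose coordinates satisfy the wanted bounds. -/
def ncW (V : AddValuation L (WithTop ℤ)) (K : Type*) [Field K] [Algebra K L]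
    (p ν n : ℕ) (Φ : ℕ → WithTop ℤ) (π x : L) : Prop :=
  ∃ a : ℕ → K, x = ∑ t ∈ Finset.range n, algebraMap K L (a t) * π ^ t ∧
    ∀ t < n, Φ (vbar p ν (n - t)) + (n : WithTop ℤ) ≤ V (algebraMap K L (a t) * π ^ t)

variable {V : AddValuation L (WithTop ℤ)} {p ν n : ℕ} {Φ : ℕ → WithTop ℤ} {π : L}

lemma ncW_zero : ncW V K p ν n Φ π 0 := ⟨fun _ => 0, by simp, by simp⟩

lemma ncW_add {x y : L} (hx : ncW V K p ν n Φ π x) (hy : ncW V K p ν n Φ π y) :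
    ncW V K p ν n Φ π (x + y) := by
  obtain ⟨a, rfl, ha⟩ := hx
  obtain ⟨b, rfl, hb⟩ := hy
  refine ⟨fun t => a t + b t, ?_, fun t ht => ?_⟩
  · rw [← Finset.sum_add_distrib]
    exact Finset.sum_congr rfl fun t _ => by rw [map_add, add_mul]
  · rw [map_add, add_mul]
    exact V.map_le_add (ha t ht) (hb t ht)

lemma ncW_neg {x : L} (hx : ncW V K p ν n Φ π x) : ncW V K p ν n Φ π (-x) := by
  obtain ⟨a, rfl, ha⟩ := hx
  refine ⟨fun t => - a t, ?_, fun t ht => ?_⟩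
  · rw [← Finset.sum_neg_distrib]
    exact Finset.sum_congr rfl fun t _ => by rw [map_neg, neg_mul]
  · rw [map_neg, neg_mul, V.map_neg]
    exact ha t ht

lemma ncW_sub {x y : L} (hx : ncW V K p ν n Φ π x) (hy : ncW V K p ν n Φ π y) :
    ncW V K p ν n Φ π (x - y) := by
  rw [sub_eq_add_neg]; exact ncW_add hx (ncW_neg hy)

lemma ncW_sum {ι : Type*} (s : Finset ι) (f : ι → L) (h : ∀ i ∈ s, ncW V K p ν n Φ π (f i)) :
    ncW V K p ν n Φ π (∑ i ∈ s, f i) := by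
  induction s using Finset.induction_on with
  | empty => simpa using ncW_zero
  | insert i s hi ih =>
    rw [Finset.sum_insert hi]
    exact ncW_add (h i (by simp)) (ih fun j hj => h j (by simp [hj]))

lemma nc_dvd_vbar (hp : p.Prime) {k : ℕ} : p ^ (vbar p ν k) ∣ k :=
  (pow_dvd_pow p (min_le_left _ _)).trans (pow_padicValNat_dvd)

lemma nc_le_vbar (hp : p.Prime) {a k : ℕ} (hk : k ≠ 0) (ha : a ≤ ν) (h : p ^ a ∣ k) :
    a ≤ vbar p ν k := by
  have := Fact.mk hp
  exact le_min ((padicValNat_dvd_iff_le hk).1 h) ha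

/-- reduction lemma -/
lemma ncW_mono (hp : p.Prime) (hpn : p ^ ν ∣ n) (hn : 0 < n) (hπ : V π = 1) (m : ℕ)
    (I : ℕ → WithTop ℤ)
    (hI0 : ∀ a, 0 ≤ I a) (r : ℕ → K)
    (hr : π ^ n = ∑ t ∈ Finset.range n, algebraMap K L (r t) * π ^ t)
    (hrn : ∀ t < n, (n : WithTop ℤ) ≤ V (algebraMap K L (r t) * π ^ t))
    (hrI : ∀ t < n, I (vbar p ν (n - t)) + (n : WithTop ℤ) ≤ V (algebraMap K L (r t) * π ^ t))
    (t : ℕ) : ∀ (d : K) (a : ℕ), a ≤ ν → p ^ a ∣ t →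
      ncPhi p m I a + (n : WithTop ℤ) ≤ V (algebraMap K L d * π ^ t) →
      ncW V K p ν n (ncPhi p m I) π (algebraMap K L d * π ^ t) := by
  induction t using Nat.strong_induction_on with
  | _ t ih =>
  intro d a ha hat hV
  by_cases htn : t < n
  · refine ⟨fun s => if s = t then d else 0, ?_, fun s hs => ?_⟩
    · rw [Finset.sum_eq_single t]
      · simp
      · intro b _ hb; simp [hb]
      · intro h; exact absurd (Finset.mem_range.2 htn) h
    · by_cases hst : s = t
      · subst hst
        simp only [if_true]
        refine le_trans (add_le_add (ncPhi_anti _ _ _ ?_) le_rfl) hV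
        exact nc_le_vbar hp (by omega) ha (Nat.dvd_sub ((pow_dvd_pow p ha).trans hpn) hat)
      · simp [hst]
  · have e : algebraMap K L d * π ^ t =
        ∑ s ∈ Finset.range n, algebraMap K L (d * r s) * π ^ (t - n + s) := by
      have : π ^ t = π ^ (t - n) * π ^ n := by rw [← pow_add]; congr 1; omega
      rw [this, hr, Finset.mul_sum, Finset.mul_sum]
      refine Finset.sum_congr rfl fun s _ => ?_
      rw [map_mul, pow_add]; ring
    rw [e]
    refine ncW_sum _ _ fun s hs => ?_
    have hs := Finset.mem_range.1 hs
    have hVV : V (algebraMap K L (d * r s) * π ^ (t - n + s)) + (n : WithTop ℤ) =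
        V (algebraMap K L d * π ^ t) + V (algebraMap K L (r s) * π ^ s) := by
      rw [← nc_Vpow V π hπ n, ← V.map_mul, ← V.map_mul]
      congr 1
      have : π ^ t = π ^ (t - n) * π ^ n := by rw [← pow_add]; congr 1; omega
      rw [this, map_mul, pow_add]; ring
    refine ih _ (by omega) _ (min a (vbar p ν (n - s))) ((min_le_left _ _).trans ha) ?_ ?_
    · have : t - n + s = t - (n - s) := by omega
      rw [this]
      exact Nat.dvd_sub ((pow_dvd_pow p (min_le_left _ _)).trans hat)
        ((pow_dvd_pow p (min_le_right _ _)).trans (nc_dvd_vbar hp))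
    · rw [← nc_cancel _ _ n, hVV]
      by_cases hc : a ≤ vbar p ν (n - s)
      · rw [min_eq_left hc]
        exact add_le_add hV (hrn s hs)
      · rw [min_eq_right (by omega)]
        calc _ ≤ (ncPhi p m I a + I (vbar p ν (n - s))) + (n : WithTop ℤ) + (n : WithTop ℤ) := by
              gcongr; exact ncPhi_add p m hp.pos I hI0 (by omega)
          _ = (ncPhi p m I a + (n : WithTop ℤ)) + (I (vbar p ν (n - s)) + (n : WithTop ℤ)) := by
              abel
          _ ≤ _ := add_le_add hV (hrI s hs)

/-- partial sums -/
def ncPart (π : L) (b : ℕ → K) (s : ℕ) : L :=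
  π + ∑ i ∈ Finset.range s, algebraMap K L (b i) * π ^ i

lemma ncPart_succ_pow (π : L) (b : ℕ → K) (s i t : ℕ) (d : K) :
    algebraMap K L d * π ^ i * ncPart π b (s + 1) ^ t =
      algebraMap K L d * π ^ i * ncPart π b s ^ t + ∑ k ∈ Finset.range t,
        algebraMap K L (d * (t.choose (k + 1) : ℕ) * b s ^ (k + 1)) * π ^ (i + s * (k + 1)) *
          ncPart π b s ^ (t - (k + 1)) := by
  have h1 : ncPart π b (s + 1) = algebraMap K L (b s) * π ^ s + ncPart π b s := by
    unfold ncPart; rw [Finset.sum_range_succ]; ring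
  rw [h1, add_pow, Finset.sum_range_succ', add_comm, mul_add]
  congr 1
  · simp
  · rw [Finset.mul_sum]
    refine Finset.sum_congr rfl fun k _ => ?_
    simp only [map_mul, map_pow, map_natCast, mul_pow, ← pow_mul, pow_add]
    ring

lemma nc_val_term (hp : p.Prime) (hπ : V π = 1) (m : ℕ) (b : ℕ → K) (s : ℕ)
    (hb : ((m + 1 : ℕ) : WithTop ℤ) ≤ V (algebraMap K L (b s) * π ^ s))
    (a i t k : ℕ) (d : K) (hkt : k ≤ t) (hk : 1 ≤ k) (hat : p ^ a ∣ t) :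
    V (algebraMap K L d * π ^ (i + t)) + (a - min a (padicValNat p k)) • V (p : L)
        + ((k * m : ℕ) : WithTop ℤ) ≤
      V (algebraMap K L (d * (t.choose k : ℕ) * b s ^ k) * π ^ (i + s * k + (t - k))) := by
  have e : algebraMap K L (d * (t.choose k : ℕ) * b s ^ k) * π ^ (i + s * k + (t - k)) =
      (algebraMap K L d * π ^ (i + t - k)) * (t.choose k : L) *
        (algebraMap K L (b s) * π ^ s) ^ k := by
    have : i + s * k + (t - k) = (i + t - k) + s * k := by omega
    rw [this]
    simp only [map_mul, map_pow, map_natCast, mul_pow, ← pow_mul, pow_add]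
    ring
  have e2 : algebraMap K L d * π ^ (i + t) = (algebraMap K L d * π ^ (i + t - k)) * π ^ k := by
    rw [mul_assoc, ← pow_add]; congr 2; omega
  rw [e, e2]
  rw [V.map_mul _ (π ^ k), V.map_mul _ ((algebraMap K L (b s) * π ^ s) ^ k),
    V.map_mul _ (t.choose k : L), V.map_pow (_ * _)]
  rw [nc_Vpow V π hπ]
  have h1 : (k : WithTop ℤ) + ((k * m : ℕ) : WithTop ℤ) ≤
      k • V (algebraMap K L (b s) * π ^ s) := by
    refine le_trans (le_of_eq ?_) (nsmul_le_nsmul_right hb k)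
    rw [nc_nsmul, ← Nat.cast_add]; congr 1; ring
  have h2 := nc_pow_dvd V p (t.choose k) _ (nc_choose p hp a t k hk hat)
  calc _ = V (algebraMap K L d * π ^ (i + t - k)) + (a - min a (padicValNat p k)) • V (p : L) +
        ((k : WithTop ℤ) + ((k * m : ℕ) : WithTop ℤ)) := by abel
    _ ≤ _ := by gcongr

lemma ncW_part (hp : p.Prime) (hpn : p ^ ν ∣ n) (hn : 0 < n) (hπ : V π = 1) (m : ℕ)
    (I : ℕ → WithTop ℤ)
    (hI0 : ∀ a, 0 ≤ I a) (he : 0 ≤ V (p : L))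
    (hI1 : ∀ a b, a ≤ b → b ≤ ν → I a ≤ I b + (b - a) • V (p : L)) (r : ℕ → K)
    (hr : π ^ n = ∑ t ∈ Finset.range n, algebraMap K L (r t) * π ^ t)
    (hrn : ∀ t < n, (n : WithTop ℤ) ≤ V (algebraMap K L (r t) * π ^ t))
    (hrI : ∀ t < n, I (vbar p ν (n - t)) + (n : WithTop ℤ) ≤ V (algebraMap K L (r t) * π ^ t))
    (b : ℕ → K) (N : ℕ)
    (hb : ∀ s < N, ((m + 1 : ℕ) : WithTop ℤ) ≤ V (algebraMap K L (b s) * π ^ s))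
    (s : ℕ) (hs : s ≤ N) : ∀ (i t : ℕ) (d : K) (a : ℕ), a ≤ ν → p ^ a ∣ i → p ^ a ∣ t →
      ncPhi p m I a + (n : WithTop ℤ) ≤ V (algebraMap K L d * π ^ (i + t)) →
      ncW V K p ν n (ncPhi p m I) π (algebraMap K L d * π ^ i * ncPart π b s ^ t) := by
  induction s with
  | zero =>
    intro i t d a ha hi ht hV
    have : algebraMap K L d * π ^ i * ncPart π b 0 ^ t = algebraMap K L d * π ^ (i + t) := by
      simp [ncPart, pow_add, mul_assoc]
    rw [this]
    exact ncW_mono hp hpn hn hπ m I hI0 r hr hrn hrI _ d a ha (dvd_add hi ht) hV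
  | succ s ih =>
    intro i t d a ha hi ht hV
    rw [ncPart_succ_pow]
    refine ncW_add (ih (by omega) i t d a ha hi ht hV) (ncW_sum _ _ fun k hk => ?_)
    have hk := Finset.mem_range.1 hk
    have hdk : p ^ (min a (padicValNat p (k + 1))) ∣ k + 1 :=
      (pow_dvd_pow p (min_le_right _ _)).trans pow_padicValNat_dvd
    have hda : p ^ (min a (padicValNat p (k + 1))) ∣ p ^ a := pow_dvd_pow p (min_le_left _ _)
    refine ih (by omega) _ _ _ (min a (padicValNat p (k + 1))) ((min_le_left _ _).trans ha)
      (dvd_add (hda.trans hi) (hdk.mul_left s)) (Nat.dvd_sub (hda.trans ht) hdk) ?_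
    refine le_trans ?_ (nc_val_term hp hπ m b s (hb s (by omega)) a i t (k + 1) d (by omega)
      (by omega) ht)
    calc _ ≤ (ncPhi p m I a + (a - min a (padicValNat p (k + 1))) • V (p : L))
              + (n : WithTop ℤ) := by
            gcongr
            exact ncPhi_smul p m ν hp.pos I _ he hI1 (min_le_left _ _) ha
      _ = (ncPhi p m I a + (n : WithTop ℤ)) + (a - min a (padicValNat p (k + 1))) • V (p : L)
            + 0 := by abel
      _ ≤ _ := by
            gcongr
            exact_mod_cast Nat.zero_le _

lemma ncW_diff (hp : p.Prime) (hpn : p ^ ν ∣ n) (hn : 0 < n) (hπ : V π = 1) (m : ℕ)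
    (I : ℕ → WithTop ℤ)
    (hI0 : ∀ a, 0 ≤ I a) (he : 0 ≤ V (p : L))
    (hI1 : ∀ a b, a ≤ b → b ≤ ν → I a ≤ I b + (b - a) • V (p : L)) (r : ℕ → K)
    (hr : π ^ n = ∑ t ∈ Finset.range n, algebraMap K L (r t) * π ^ t)
    (hrn : ∀ t < n, (n : WithTop ℤ) ≤ V (algebraMap K L (r t) * π ^ t))
    (hrI : ∀ t < n, I (vbar p ν (n - t)) + (n : WithTop ℤ) ≤ V (algebraMap K L (r t) * π ^ t))
    (b : ℕ → K) (N : ℕ)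
    (hb : ∀ s < N, ((m + 1 : ℕ) : WithTop ℤ) ≤ V (algebraMap K L (b s) * π ^ s))
    (t : ℕ) (d : K) (a : ℕ) (ha : a ≤ ν) (hat : p ^ a ∣ t)
    (hd : ∀ a' ≤ a, I a' + (n : WithTop ℤ) ≤
      V (algebraMap K L d * π ^ t) + (a - a') • V (p : L))
    (s : ℕ) (hs : s ≤ N) :
    ncW V K p ν n (ncPhi p m I) π (algebraMap K L d * (ncPart π b s ^ t - π ^ t)) := by
  induction s with
  | zero => simpa [ncPart] using ncW_zero
  | succ s ih =>
    have e : algebraMap K L d * (ncPart π b (s + 1) ^ t - π ^ t) =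
        algebraMap K L d * (ncPart π b s ^ t - π ^ t) + ∑ k ∈ Finset.range t,
        algebraMap K L (d * (t.choose (k + 1) : ℕ) * b s ^ (k + 1)) * π ^ (0 + s * (k + 1)) *
          ncPart π b s ^ (t - (k + 1)) := by
      have := ncPart_succ_pow π b s 0 t d
      rw [pow_zero, mul_one] at this
      rw [mul_sub, this]; ring
    rw [e]
    refine ncW_add (ih (by omega)) (ncW_sum _ _ fun k hk => ?_)
    have hk := Finset.mem_range.1 hk
    have hdk : p ^ (min a (padicValNat p (k + 1))) ∣ k + 1 :=
      (pow_dvd_pow p (min_le_right _ _)).trans pow_padicValNat_dvd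
    have hda : p ^ (min a (padicValNat p (k + 1))) ∣ p ^ a := pow_dvd_pow p (min_le_left _ _)
    refine ncW_part hp hpn hn hπ m I hI0 he hI1 r hr hrn hrI b N hb s (by omega) _ _ _
      (min a (padicValNat p (k + 1))) ((min_le_left _ _).trans ha)
      (dvd_add (dvd_zero _) (hdk.mul_left s)) (Nat.dvd_sub (hda.trans hat) hdk) ?_
    refine le_trans ?_ (nc_val_term hp hπ m b s (hb s (by omega)) a 0 t (k + 1) d (by omega)
      (by omega) hat)
    rw [zero_add]
    calc _ ≤ (I (min a (padicValNat p (k + 1))) +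
              ((p ^ (min a (padicValNat p (k + 1))) * m : ℕ) : WithTop ℤ)) + (n : WithTop ℤ) := by
            gcongr
            exact ncPhi_le p m I le_rfl
      _ = (I (min a (padicValNat p (k + 1))) + (n : WithTop ℤ)) +
              ((p ^ (min a (padicValNat p (k + 1))) * m : ℕ) : WithTop ℤ) := by abel
      _ ≤ _ := add_le_add (hd _ (min_le_left _ _))
            (nc_cast_le (Nat.mul_le_mul (Nat.le_of_dvd (by omega) hdk) le_rfl))

/-- coordinates with respect to another uniformizer -/
lemma ncW_coord (vK : K → WithTop ℤ) (hn : 0 < n)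
    (htot : ∀ x : K, V (algebraMap K L x) = n • vK x) (hπ : V π = 1)
    (ϖ : L) (hϖ : V ϖ = 1)
    (hgen : ∀ (d : K) (t : ℕ), t < n →
      Φ (vbar p ν (n - t)) + (n : WithTop ℤ) ≤ V (algebraMap K L d * ϖ ^ t) →
      ncW V K p ν n Φ π (algebraMap K L d * ϖ ^ t))
    (g : ℕ → K)
    (hg : ncW V K p ν n Φ π (∑ t ∈ Finset.range n, algebraMap K L (g t) * ϖ ^ t))
    (t : ℕ) (ht : t < n) :
    Φ (vbar p ν (n - t)) + (n : WithTop ℤ) ≤ V (algebraMap K L (g t) * ϖ ^ t) := by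
  by_contra hbad
  let P : ℕ → Prop := fun t =>
    Φ (vbar p ν (n - t)) + (n : WithTop ℤ) ≤ V (algebraMap K L (g t) * ϖ ^ t)
  have hsplit : ∑ t ∈ Finset.range n, algebraMap K L (if P t then 0 else g t) * ϖ ^ t =
      ∑ t ∈ Finset.range n, algebraMap K L (g t) * ϖ ^ t -
      ∑ t ∈ Finset.range n, algebraMap K L (if P t then g t else 0) * ϖ ^ t := by
    rw [← Finset.sum_sub_distrib]
    refine Finset.sum_congr rfl fun s _ => ?_
    split_ifs <;> simp
  have hW : ncW V K p ν n Φ π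
      (∑ t ∈ Finset.range n, algebraMap K L (if P t then 0 else g t) * ϖ ^ t) := by
    rw [hsplit]
    refine ncW_sub hg (ncW_sum _ _ fun s hs => ?_)
    have hs := Finset.mem_range.1 hs
    by_cases hP : P s
    · rw [if_pos hP]; exact hgen _ _ hs hP
    · rw [if_neg hP]; simpa using ncW_zero
  obtain ⟨s, hs, hSs, hSle⟩ := nc_sum V n hn vK htot ϖ hϖ (fun t => if P t then 0 else g t)
  obtain ⟨a, ha, haV⟩ := hW
  obtain ⟨s', hs', hSs', _⟩ := nc_sum V n hn vK htot π hπ a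
  have hPt : ¬ P t := hbad
  have hfin : V (∑ t ∈ Finset.range n, algebraMap K L (if P t then 0 else g t) * ϖ ^ t) ≠ ⊤ := by
    have := hSle t ht
    rw [if_neg hPt] at this
    exact ne_top_of_lt (lt_of_le_of_lt this (not_le.1 hbad))
  have hPs : ¬ P s := by
    intro h
    rw [if_pos h] at hSs
    apply hfin
    rw [hSs]; simp
  have hss : s = s' := by
    refine nc_distinct V n vK htot ϖ π hϖ hπ (if P s then 0 else g s) (a s') s s' hs hs' ?_ (by rw [← hSs]; exact hfin)
    rw [← hSs, ← hSs', ha]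
  apply hPs
  have h1 := haV s' hs'
  rw [← hSs', ← ha, hSs, if_neg hPs, ← hss] at h1
  exact h1

end

end NCHelpers

/-- **Theorem (nochange).**  Let `π_L`, `π̃_L` be uniformizers of the totally ramified
separable extension `L/K` of degree `n = u·p^ν`, with minimal polynomials
`f(X) = X^n - c_1 X^{n-1} + ⋯ + (-1)^n c_n` and
`f̃(X) = X^n - c̃_1 X^{n-1} + ⋯ + (-1)^n c̃_n` over `K`.  If there are `ℓ ≥ 1` and a
`K`-automorphism `σ` of `L` with `σ(π̃_L) ≡ π_L (mod M_L^{ℓ+1})`, then for all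
`1 ≤ h ≤ n` one has `c̃_h ≡ c_h (mod M_K^{ρ_h(ℓ)})`, where
`ρ_h(ℓ) = ⌈(φ_j(ℓ) + h)/n⌉` with `j = v̄_p(h)`. -/
theorem nochange {K L : Type*} [Field K] [Field L] [Algebra K L]
    [FiniteDimensional K L] [Algebra.IsSeparable K L]
    (p u ν n : ℕ) (hp : p.Prime) (hu : ¬ p ∣ u) (hn : n = u * p ^ ν)
    (hdim : Module.finrank K L = n)
    (vK : K → WithTop ℤ) (vL : L → WithTop ℤ)
    (hvK : IsDiscreteValuationOn vK) (hvL : IsDiscreteValuationOn vL)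
    (hKcomplete : IsCompleteWrt vK)
    (hres : HasPerfectResidueFieldCharP vK p)
    (htotram : ∀ x : K, vL (algebraMap K L x) = n • vK x)
    (π πt : L) (hπ : vL π = 1) (hπt : vL πt = 1)
    (ℓ : ℕ) (hℓ : 1 ≤ ℓ) (σ : L ≃ₐ[K] L)
    (hcong : (((ℓ + 1 : ℕ) : ℤ) : WithTop ℤ) ≤ vL (σ πt - π))
    (h : ℕ) (hh1 : 1 ≤ h) (hhn : h ≤ n) :
    ((phiIdx vK p ν n (vL (p : L)) (minpolyCoeff K n π) (vbar p ν h) ℓ).map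
        fun a : ℤ => (⌈((a : ℚ) + (h : ℚ)) / (n : ℚ)⌉ : ℤ)) ≤
      vK (minpolyCoeff K n πt h - minpolyCoeff K n π h) := by
  obtain ⟨V, hV⟩ : ∃ V : AddValuation L (WithTop ℤ), ∀ x, V x = vL x := by
    have h1 : vL 1 = 0 := by
      have h := hvL.map_mul 1 1
      have hne : vL 1 ≠ ⊤ := fun h => one_ne_zero ((hvL.eq_top_iff 1).1 h)
      rw [mul_one] at h
      lift vL 1 to ℤ using hne with z
      norm_cast at h ⊢
      omega
    exact ⟨AddValuation.of vL ((hvL.eq_top_iff 0).2 rfl) h1 hvL.min_le_add hvL.map_mul,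
      fun x => rfl⟩
  have htot : ∀ x : K, V (algebraMap K L x) = n • vK x := fun x => by rw [hV, htotram]
  simp only [← hV] at hπ hπt hcong ⊢
  have hn0 : 0 < n := by omega
  have hpn : p ^ ν ∣ n := ⟨u, by rw [hn, mul_comm]⟩
  have he : 0 ≤ V (p : L) := nc_nat_nonneg V p
  -- replace the second uniformizer by its conjugate
  set ϖ : L := σ πt with hϖdef
  have hmp : minpoly K πt = minpoly K ϖ := (minpoly.algEquiv_eq σ πt).symm
  have hcong' : ((ℓ + 1 : ℕ) : WithTop ℤ) ≤ V (ϖ - π) := by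
    rw [nc_natCast]; exact hcong
  have hϖ : V ϖ = 1 := by
    rw [← hπ]
    refine V.map_eq_of_lt_sub (lt_of_lt_of_le ?_ hcong')
    rw [hπ]
    have : ((1 : ℕ) : WithTop ℤ) < ((ℓ + 1 : ℕ) : WithTop ℤ) := by
      exact_mod_cast (by omega : 1 < ℓ + 1)
    simpa using this
  have hcne : ∀ (c : K) (j : ℕ), V (algebraMap K L ((-1) ^ j * c)) = V (algebraMap K L c) := by
    intro c j
    rcases neg_one_pow_eq_or K j with h | h <;> rw [h] <;> simp [V.map_neg]
  -- the Eisenstein relation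
  set r : ℕ → K := fun t => -(minpoly K π).coeff t with hrdef
  have hr : π ^ n = ∑ t ∈ Finset.range n, algebraMap K L (r t) * π ^ t :=
    nc_minpoly V n hn0 vK hdim htot π hπ
  set r' : ℕ → K := fun t => -(minpoly K ϖ).coeff t with hr'def
  have hr' : ϖ ^ n = ∑ t ∈ Finset.range n, algebraMap K L (r' t) * ϖ ^ t :=
    nc_minpoly V n hn0 vK hdim htot ϖ hϖ
  obtain ⟨t0, ht0, hVt0, hrn⟩ := nc_sum V n hn0 vK htot π hπ r
  rw [← hr, nc_Vpow V π hπ] at hVt0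
  have hrn : ∀ t < n, (n : WithTop ℤ) ≤ V (algebraMap K L (r t) * π ^ t) := by
    intro t ht
    have := hrn t ht
    rwa [← hr, nc_Vpow V π hπ] at this
  have hr0 : V (algebraMap K L (r 0) * π ^ 0) = (n : WithTop ℤ) := by
    obtain ⟨y, hy⟩ := hvK.surjective 1
    have hVy : V (algebraMap K L y * π ^ 0) = (n : WithTop ℤ) := by
      rw [pow_zero, mul_one, htot, hy]
      simp
    have h00 : (0 : ℕ) = t0 := nc_distinct V n vK htot π π hπ hπ y (r t0) 0 t0 hn0 ht0
      (by rw [hVy, hVt0]) (by rw [hVy, nc_natCast]; exact WithTop.coe_ne_top)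
    rw [← h00] at hVt0
    exact hVt0.symm
  set c := minpolyCoeff K n π with hcdef
  have hcr : ∀ t < n, V (algebraMap K L (r t)) = n • vK (c (n - t)) := by
    intro t ht
    rw [← htot, hcdef]
    simp only [minpolyCoeff]
    rw [hcne, hrdef]
    simp only [map_neg, V.map_neg]
    rw [Nat.sub_sub_self ht.le]
  -- the value `n v(c_h) - h`
  have hval : ∀ t < n, (vK (c (n - t))).map (fun a => (n : ℤ) * a - ((n - t : ℕ) : ℤ)) +
      (n : WithTop ℤ) = V (algebraMap K L (r t) * π ^ t) := by
    intro t ht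
    rw [V.map_mul, nc_Vpow V π hπ, hcr t ht]
    rcases vK (c (n - t)) with _ | x
    · obtain ⟨n', rfl⟩ : ∃ n', n = n' + 1 := ⟨n - 1, by omega⟩
      change ⊤ + _ = (n' + 1) • (⊤ : WithTop ℤ) + _
      rw [succ_nsmul]; simp
    · rw [nc_natCast, nc_natCast]
      change (((n : ℤ) * x - ((n - t : ℕ) : ℤ) + n : ℤ) : WithTop ℤ) =
        ((n • x + (t : ℤ) : ℤ) : WithTop ℤ)
      congr 1
      rw [nsmul_eq_mul]; push_cast [ht.le]; ring
  set I : ℕ → WithTop ℤ := insepIdx vK p ν n (V (p : L)) c with hIdef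
  have hI0 : ∀ a, 0 ≤ I a := by
    intro a
    refine Finset.le_inf fun j _ => add_nonneg (Finset.le_inf fun k hk => ?_) (nsmul_nonneg he _)
    have hk := Finset.mem_Icc.1 (Finset.mem_filter.1 hk).1
    have h1 := hval (n - k) (by omega)
    have h2 := hrn (n - k) (by omega)
    rw [← h1, Nat.sub_sub_self hk.2] at h2
    rw [← nc_cancel _ _ n, zero_add]
    exact h2
  have hI1 : ∀ a b, a ≤ b → b ≤ ν → I a ≤ I b + (b - a) • V (p : L) := by
    intro a b hab hb
    obtain ⟨j, hj, hjeq⟩ := Finset.exists_mem_eq_inf (Finset.Icc b ν) ⟨b, by simp [hb]⟩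
      (fun j' => iPi vK p ν n c j' + (j' - b) • V (p : L))
    have hj := Finset.mem_Icc.1 hj
    have : I b = iPi vK p ν n c j + (j - b) • V (p : L) := hjeq
    rw [this, add_assoc, ← add_nsmul]
    have e : j - b + (b - a) = j - a := by omega
    rw [e]
    exact Finset.inf_le (f := fun j' => iPi vK p ν n c j' + (j' - a) • V (p : L))
      (Finset.mem_Icc.2 ⟨by omega, hj.2⟩)
  have hrI' : ∀ t < n, ∀ a ≤ vbar p ν (n - t), I a + (n : WithTop ℤ) ≤
      V (algebraMap K L (r t) * π ^ t) + (vbar p ν (n - t) - a) • V (p : L) := by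
    intro t ht a ha
    rw [← hval t ht, add_right_comm]
    refine add_le_add ?_ le_rfl
    calc I a ≤ iPi vK p ν n c (vbar p ν (n - t)) + (vbar p ν (n - t) - a) • V (p : L) :=
          Finset.inf_le (f := fun j' => iPi vK p ν n c j' + (j' - a) • V (p : L))
            (Finset.mem_Icc.2 ⟨ha, min_le_right _ _⟩)
      _ ≤ _ := by
          refine add_le_add ?_ le_rfl
          exact Finset.inf_le (f := fun h => (vK (c h)).map fun a => (n : ℤ) * a - (h : ℤ))
            (Finset.mem_filter.2 ⟨Finset.mem_Icc.2 ⟨by omega, by omega⟩, le_rfl⟩)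
  have hrI : ∀ t < n, I (vbar p ν (n - t)) + (n : WithTop ℤ) ≤
      V (algebraMap K L (r t) * π ^ t) := by
    intro t ht
    simpa using hrI' t ht _ le_rfl
  have hvn : vbar p ν n = ν :=
    le_antisymm (min_le_right _ _) (nc_le_vbar hp (by omega) le_rfl hpn)
  -- expansion of the difference
  obtain ⟨b, hb⟩ := (nc_repr V n hn0 vK hdim htot π hπ).1 (ϖ - π)
  have hbV : ∀ s < n, ((ℓ + 1 : ℕ) : WithTop ℤ) ≤ V (algebraMap K L (b s) * π ^ s) := by
    intro s hs
    obtain ⟨_, _, _, hle⟩ := nc_sum V n hn0 vK htot π hπ b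
    exact (hb ▸ hcong').trans (hle s hs)
  have hpart : ncPart π b n = ϖ := by
    unfold ncPart; rw [← hb]; ring
  have hW : ncW V K p ν n (ncPhi p ℓ I) π
      (∑ t ∈ Finset.range n, algebraMap K L (r' t - r t) * ϖ ^ t) := by
    have e : ∑ t ∈ Finset.range n, algebraMap K L (r' t - r t) * ϖ ^ t =
        algebraMap K L 1 * (ncPart π b n ^ n - π ^ n) -
          ∑ t ∈ Finset.range n, algebraMap K L (r t) * (ncPart π b n ^ t - π ^ t) := by
      simp only [map_sub, sub_mul, mul_sub, Finset.sum_sub_distrib, map_one, one_mul, hpart]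
      rw [← hr, ← hr']; ring
    rw [e]
    refine ncW_sub ?_ (ncW_sum _ _ fun t ht => ?_)
    · refine ncW_diff hp hpn hn0 hπ ℓ I hI0 he hI1 r hr hrn hrI b n hbV n 1 ν le_rfl hpn ?_ n le_rfl
      intro a ha
      have := hrI' 0 hn0 a (by rw [Nat.sub_zero, hvn]; exact ha)
      rw [hr0, Nat.sub_zero, hvn] at this
      rw [map_one, one_mul, nc_Vpow V π hπ]
      exact this
    · have ht := Finset.mem_range.1 ht
      refine ncW_diff hp hpn hn0 hπ ℓ I hI0 he hI1 r hr hrn hrI b n hbV t (r t)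
        (vbar p ν (n - t)) (min_le_right _ _) ?_ (hrI' t ht) n le_rfl
      have h1 : p ^ vbar p ν (n - t) ∣ n := (pow_dvd_pow p (min_le_right _ _)).trans hpn
      have h2 : p ^ vbar p ν (n - t) ∣ n - t := nc_dvd_vbar hp
      have := Nat.dvd_sub h1 h2
      rwa [Nat.sub_sub_self ht.le] at this
  have hfin := ncW_coord vK hn0 htot hπ ϖ hϖ (fun d t ht hd => by
    have h1 : p ^ vbar p ν (n - t) ∣ n := (pow_dvd_pow p (min_le_right _ _)).trans hpn
    have h2 : p ^ vbar p ν (n - t) ∣ n - t := nc_dvd_vbar hp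
    have h3 := Nat.dvd_sub h1 h2
    rw [Nat.sub_sub_self ht.le] at h3
    have := ncW_part hp hpn hn0 hπ ℓ I hI0 he hI1 r hr hrn hrI b n hbV n le_rfl 0 t d
      (vbar p ν (n - t)) (min_le_right _ _) (dvd_zero _) h3 (by
        rw [zero_add, V.map_mul, nc_Vpow V π hπ]
        rwa [V.map_mul, nc_Vpow V ϖ hϖ] at hd)
    rwa [hpart, pow_zero, mul_one] at this) (fun t => r' t - r t) hW (n - h) (by omega)
  rw [Nat.sub_sub_self hhn, V.map_mul, nc_Vpow V ϖ hϖ] at hfin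
  have hdiff : V (algebraMap K L (r' (n - h) - r (n - h))) =
      n • vK (minpolyCoeff K n πt h - c h) := by
    rw [← htot, hcdef]
    simp only [minpolyCoeff]
    rw [hmp, ← mul_sub, hcne, hrdef, hr'def]
    simp only
    rw [← V.map_neg, ← map_neg]
    congr 2
    ring
  rw [hdiff] at hfin
  have hphi : phiIdx vK p ν n (V (p : L)) c (vbar p ν h) ℓ = ncPhi p ℓ I (vbar p ν h) := by
    simp only [phiIdx, phiTilde, ncPhi, hIdef, nc_natCast]
  rw [hphi]
  generalize ncPhi p ℓ I (vbar p ν h) = A at hfin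
  generalize vK (minpolyCoeff K n πt h - c h) = B at hfin
  rcases B with _ | y
  · exact le_top
  rw [nc_natCast, nc_natCast] at hfin
  rcases A with _ | x
  · exfalso
    have h1 : (⊤ : WithTop ℤ) ≤ ((n • y + ((n - h : ℕ) : ℤ) : ℤ) : WithTop ℤ) := hfin
    exact WithTop.coe_ne_top (top_le_iff.1 h1)
  have h1 : ((x + (n : ℤ) : ℤ) : WithTop ℤ) ≤ ((n • y + ((n - h : ℕ) : ℤ) : ℤ) : WithTop ℤ) := hfin
  rw [WithTop.coe_le_coe, nsmul_eq_mul] at h1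
  push_cast [hhn] at h1
  change ((⌈((x : ℚ) + (h : ℚ)) / (n : ℚ)⌉ : ℤ) : WithTop ℤ) ≤ ((y : ℤ) : WithTop ℤ)
  rw [WithTop.coe_le_coe, Int.ceil_le, div_le_iff₀ (by exact_mod_cast hn0)]
  have h2 : x + (h : ℤ) ≤ y * n := by linarith
  exact_mod_cast h2


end
end

section
/- Let π_L be a uniformizer for L with minimum polynomial f(X) = X^n − c_1X^{n−1} + ⋯ + (−1)^n c_n over K. Let ℓ ≥ 1, let r ∈ O_K, and set π̃_L = π_L + r·π_L^{ℓ+1}; let f̃(X) = X^n − c̃_1X^{n−1} + ⋯ + (−1)^n c̃_n be the minimum polynomial of π̃_L over K. Then for every h with 1 ≤ h ≤ n, one has c̃_h ≡ c_h (mod M_K^{ρ_h(ℓ)}). -/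
open scoped Classical

noncomputable section

section UniversalPart
open MvPolynomial

variable {ι : Type*} [Fintype ι]

/-- evaluation at the elementary symmetric polynomials -/
def evE (ι : Type*) [Fintype ι] (n : ℕ) : MvPolynomial (Fin n) ℤ →ₐ[ℤ] MvPolynomial ι ℤ :=
  aeval fun i : Fin n => esymm ι ℤ ((i : ℕ) + 1)

lemma evE_injective {n : ℕ} (hn : Fintype.card ι = n) : Function.Injective (evE ι n) := by
  intro a b hab
  apply esymmAlgHom_injective (σ := ι) ℤ hn.ge
  apply Subtype.ext
  simpa only [esymmAlgHom_apply, evE] using hab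

lemma evE_surj {n : ℕ} (hn : Fintype.card ι = n) (F : MvPolynomial ι ℤ) (hF : F.IsSymmetric) :
    ∃ D, evE ι n D = F := by
  obtain ⟨D, hD⟩ := esymmAlgHom_surjective (σ := ι) (n := n) ℤ hn.le ⟨F, hF⟩
  refine ⟨D, ?_⟩
  have := congrArg Subtype.val hD
  simpa only [esymmAlgHom_apply, evE] using this

lemma esymm_isHomog (m : ℕ) : (esymm ι ℤ m).IsHomogeneous m := by
  unfold esymm
  apply IsHomogeneous.sum
  intro t ht
  have h2 := IsHomogeneous.prod t (fun i => (X i : MvPolynomial ι ℤ)) (fun _ => 1)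
    (fun i _ => isHomogeneous_X _ _)
  rw [Finset.mem_powersetCard] at ht
  simpa [ht.2] using h2

lemma evE_homog {n : ℕ} (w : ℕ) (D : MvPolynomial (Fin n) ℤ) :
    homogeneousComponent w (evE ι n D) =
      evE ι n (weightedHomogeneousComponent (fun i : Fin n => (i : ℕ) + 1) w D) := by
  induction D using MvPolynomial.induction_on' with
  | add p q hp hq => simp only [map_add, hp, hq]
  | monomial d a =>
    have h1 : (evE ι n (monomial d a)).IsHomogeneous
        (Finsupp.weight (fun i : Fin n => (i : ℕ) + 1) d) := by
      rw [evE, aeval_monomial, Finsupp.prod, Finsupp.weight_apply, Finsupp.sum]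
      have h3 := IsHomogeneous.prod d.support
        (fun i => esymm ι ℤ ((i : ℕ) + 1) ^ d i) (fun i => ((i : ℕ) + 1) * d i)
        (fun i _ => (esymm_isHomog _).pow _)
      have h4 := (isHomogeneous_C ι a).mul h3
      rw [zero_add] at h4
      have h5 : ∑ a ∈ d.support, d a • ((a : ℕ) + 1) = ∑ i ∈ d.support, ((i : ℕ) + 1) * d i :=
        Finset.sum_congr rfl fun i _ => by rw [smul_eq_mul, mul_comm]
      rw [h5]
      exact h4
    rw [homogeneousComponent_of_mem h1,
      weightedHomogeneousComponent_of_mem (isWeightedHomogeneous_monomial _ d a rfl)]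
    split_ifs <;> simp

lemma evE_isWH {n : ℕ} (hn : Fintype.card ι = n) (w : ℕ) (D : MvPolynomial (Fin n) ℤ)
    (h : (evE ι n D).IsHomogeneous w) :
    D.IsWeightedHomogeneous (fun i : Fin n => (i : ℕ) + 1) w := by
  have h1 := evE_homog (ι := ι) w D
  rw [homogeneousComponent_of_mem h, if_pos rfl] at h1
  rw [evE_injective hn h1]
  exact weightedHomogeneousComponent_isWeightedHomogeneous _ _

/-- reduce mod `q` and kill the variables with index prime to `q` -/
def killE (n q : ℕ) : MvPolynomial (Fin n) ℤ →ₐ[ℤ] MvPolynomial (Fin n) (ZMod q) :=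
  aeval fun i : Fin n => if q ∣ (i : ℕ) + 1 then X i else 0

lemma killE_coeff (n q : ℕ) (D : MvPolynomial (Fin n) ℤ) (d : Fin n →₀ ℕ)
    (hd : ∀ i ∈ d.support, q ∣ (i : ℕ) + 1) :
    coeff d (killE n q D) = ((coeff d D : ℤ) : ZMod q) := by
  induction D using MvPolynomial.induction_on' with
  | add p q' hp hq => simp only [map_add, coeff_add, hp, hq, Int.cast_add]
  | monomial e a =>
    rw [killE, aeval_monomial, Finsupp.prod, coeff_monomial]
    by_cases he : ∀ i ∈ e.support, q ∣ (i : ℕ) + 1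
    · have : ∏ i ∈ e.support, (if q ∣ (i : ℕ) + 1 then (X i : MvPolynomial (Fin n) (ZMod q)) else 0)
          ^ e i = monomial e 1 := by
        rw [monomial_eq, C_1, one_mul, Finsupp.prod]
        refine Finset.prod_congr rfl fun i hi => ?_
        rw [if_pos (he i hi)]
      rw [this]
      have h2 : (algebraMap ℤ (MvPolynomial (Fin n) (ZMod q))) a = C (a : ZMod q) := by simp
      rw [h2, coeff_C_mul, coeff_monomial]
      split_ifs <;> simp
    · push Not at he
      obtain ⟨i, hi, hq⟩ := he
      rw [Finset.prod_eq_zero hi, mul_zero, coeff_zero, if_neg]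
      · simp
      · rintro rfl
        exact hq (hd i hi)
      · rw [if_neg hq, zero_pow (Finsupp.mem_support_iff.mp hi)]

/-- symmetric polynomials -/
def InR (ι : Type*) [Fintype ι] (n : ℕ) (F : MvPolynomial ι ℤ) : Prop := ∃ D, evE ι n D = F

/-- symmetric polynomials killed by `killE` -/
def InJ (ι : Type*) [Fintype ι] (n q : ℕ) (F : MvPolynomial ι ℤ) : Prop :=
  ∃ D, evE ι n D = F ∧ killE n q D = 0

lemma InJ.mul {n q : ℕ} {F G : MvPolynomial ι ℤ} (hF : InR ι n F) (hG : InJ ι n q G) :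
    InJ ι n q (F * G) := by
  obtain ⟨D, rfl⟩ := hF
  obtain ⟨E, rfl, hE⟩ := hG
  exact ⟨D * E, by simp, by simp [hE]⟩

lemma InJ.sum {n q : ℕ} {α : Type*} (s : Finset α) (F : α → MvPolynomial ι ℤ)
    (h : ∀ a ∈ s, InJ ι n q (F a)) : InJ ι n q (∑ a ∈ s, F a) := by
  choose! D h1 h2 using h
  refine ⟨∑ a ∈ s, D a, ?_, ?_⟩
  · rw [map_sum]; exact Finset.sum_congr rfl h1
  · rw [map_sum]; exact Finset.sum_eq_zero h2

lemma InJ.sub {n q : ℕ} {F G : MvPolynomial ι ℤ} (hF : InJ ι n q F) (hG : InJ ι n q G) :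
    InJ ι n q (F - G) := by
  obtain ⟨D, rfl, hD⟩ := hF
  obtain ⟨E, rfl, hE⟩ := hG
  exact ⟨D - E, by simp, by simp [hD, hE]⟩

lemma InR.int {n : ℕ} (a : ℤ) : InR ι n (a : MvPolynomial ι ℤ) := ⟨a, by simp⟩
lemma InR.nat {n : ℕ} (a : ℕ) : InR ι n (a : MvPolynomial ι ℤ) := ⟨a, by simp⟩
lemma InR.sign {n : ℕ} (a : ℕ) : InR ι n ((-1) ^ a : MvPolynomial ι ℤ) := ⟨(-1) ^ a, by simp⟩
lemma InR.mul {n : ℕ} {F G : MvPolynomial ι ℤ} (hF : InR ι n F) (hG : InR ι n G) :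
    InR ι n (F * G) := by
  obtain ⟨D, rfl⟩ := hF
  obtain ⟨E, rfl⟩ := hG
  exact ⟨D * E, by simp⟩

lemma InR.esymm {n : ℕ} (hn : Fintype.card ι = n) (m : ℕ) : InR ι n (esymm ι ℤ m) :=
  evE_surj hn _ (esymm_isSymmetric _ _ _)

lemma InJ.nat_mul_esymm {n q : ℕ} (hn : Fintype.card ι = n) (m : ℕ) (hm : 0 < m) :
    InJ ι n q ((m : MvPolynomial ι ℤ) * MvPolynomial.esymm ι ℤ m) := by
  by_cases hmn : m ≤ n
  · refine ⟨(m : MvPolynomial (Fin n) ℤ) * X (⟨m - 1, by omega⟩ : Fin n), ?_, ?_⟩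
    · simp [evE, Nat.sub_add_cancel hm]
    · rw [map_mul, map_natCast, killE, aeval_X]
      simp only [Nat.sub_add_cancel hm]
      split_ifs with hq
      · have : ((m : ℕ) : MvPolynomial (Fin n) (ZMod q)) = C ((m : ZMod q)) := by simp
        rw [this, (ZMod.natCast_eq_zero_iff m q).2 hq]; simp
      · simp
  · have : MvPolynomial.esymm ι ℤ m = 0 := by
      rw [MvPolynomial.esymm, Finset.powersetCard_eq_empty.2 (by rw [Finset.card_univ]; omega)]
      simp
    exact ⟨0, by simp [this], by simp⟩

lemma InJ.psum {n q : ℕ} (hn : Fintype.card ι = n) (m : ℕ) (hm : 0 < m) :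
    InJ ι n q (MvPolynomial.psum ι ℤ m) := by
  induction m using Nat.strong_induction_on with
  | _ m ih =>
    rw [psum_eq_mul_esymm_sub_sum _ _ m hm]
    apply InJ.sub
    · rw [mul_assoc]
      exact InJ.mul (InR.sign _) (InJ.nat_mul_esymm hn m hm)
    · apply InJ.sum
      rintro ⟨a, b⟩ hab
      simp only [Finset.mem_filter, Finset.HasAntidiagonal.mem_antidiagonal, Set.mem_Ioo] at hab
      exact InJ.mul ((InR.sign _).mul (InR.esymm hn _)) (ih b (by omega) (by omega))

/-- derivative of elementary symmetric polynomials -/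
lemma pderiv_esymm_succ (i : ι) (h : ℕ) :
    pderiv i (esymm ι ℤ (h + 1)) = esymm ι ℤ h - X i * pderiv i (esymm ι ℤ h) := by
  have key : ∀ m, ∃ E : ℕ → MvPolynomial ι ℤ, E 0 = 1 ∧ esymm ι ℤ 0 = E 0 ∧
      (∀ k ≤ m, esymm ι ℤ (k + 1) = E (k + 1) + X i * E k) ∧ ∀ k, pderiv i (E k) = 0 := by
    intro m
    have hu : (Finset.univ : Finset ι).val = i ::ₘ (Finset.univ.erase i).val := by
      rw [← Finset.insert_val_of_notMem (Finset.notMem_erase i _),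
        Finset.insert_erase (Finset.mem_univ i)]
    refine ⟨fun k => ((Finset.univ.erase i).val.map X).esymm k, by simp [Multiset.esymm],
      by simp [Multiset.esymm], ?_, ?_⟩
    · intro k _
      rw [esymm_eq_multiset_esymm, hu, Multiset.map_cons]
      simp only [Multiset.esymm, Multiset.powersetCard_cons, Multiset.map_add, Multiset.sum_add,
        Multiset.map_map, Function.comp_def, Multiset.prod_cons]
      rw [Multiset.sum_map_mul_left]
    · intro k
      dsimp only
      rw [Finset.esymm_map_val, map_sum]
      refine Finset.sum_eq_zero fun t ht => ?_
      rw [Finset.mem_powersetCard] at ht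
      apply pderiv_eq_zero_of_notMem_vars
      intro hv
      have := vars_prod _ hv
      simp only [Finset.mem_biUnion, vars_X, Finset.mem_singleton] at this
      obtain ⟨j, hj, rfl⟩ := this
      exact (Finset.mem_erase.mp (ht.1 hj)).1 rfl
  obtain ⟨E, h0, h1, h2, h3⟩ := key h
  rw [h2 h le_rfl]
  rcases h with _ | h
  · rw [h1]; simp [h3, h0, Derivation.leibniz]
  · rw [h2 h (by omega)]
    simp [h3, Derivation.leibniz]

lemma pderiv_esymm (i : ι) (h : ℕ) :
    pderiv i (esymm ι ℤ h) =
      ∑ k ∈ Finset.range h, (-1) ^ k * esymm ι ℤ (h - 1 - k) * X i ^ k := by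
  induction h with
  | zero => simp
  | succ h ih =>
    rw [pderiv_esymm_succ, ih, Finset.sum_range_succ', Finset.mul_sum, add_comm, sub_eq_add_neg,
      ← Finset.sum_neg_distrib]
    congr 1
    · simp
    · refine Finset.sum_congr rfl fun k _ => ?_
      rw [show h + 1 - 1 - (k + 1) = h - 1 - k by omega]
      ring

/-- perturbed variables -/
def pw (ι : Type*) (ℓ : ℕ) (i : ι) : Polynomial (MvPolynomial ι ℤ) :=
  Polynomial.C (X i) + Polynomial.X * Polynomial.C (X i ^ (ℓ + 1))

/-- elementary symmetric polynomial in the perturbed variables -/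
def pe (ι : Type*) [Fintype ι] (ℓ h : ℕ) : Polynomial (MvPolynomial ι ℤ) :=
  aeval (pw ι ℓ) (esymm ι ℤ h)

lemma pe_symm (ℓ h g : ℕ) : ((pe ι ℓ h).coeff g).IsSymmetric := by
  intro e
  have h1 : Polynomial.map ((rename e : _ →ₐ[ℤ] MvPolynomial ι ℤ) : _ →+* MvPolynomial ι ℤ)
      (pe ι ℓ h) = pe ι ℓ h := by
    conv_rhs => rw [pe, ← rename_esymm ι ℤ h e, aeval_rename]
    rw [pe, ← Polynomial.coe_mapRingHom, esymm, map_sum, map_sum, map_sum]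
    refine Finset.sum_congr rfl fun t _ => ?_
    rw [map_prod, map_prod, map_prod]
    refine Finset.prod_congr rfl fun i _ => ?_
    simp [pw]
  conv_rhs => rw [← h1]
  rw [Polynomial.coeff_map]; rfl

lemma pw_pow_coeff {ι : Type*} (ℓ k g : ℕ) (i : ι) :
    (pw ι ℓ i ^ k).coeff g = (k.choose g : MvPolynomial ι ℤ) * X i ^ (k + g * ℓ) := by
  have h1 : pw ι ℓ i = Polynomial.C (X i) * (1 + Polynomial.C (X i ^ ℓ) * Polynomial.X) := by
    rw [pw, pow_succ, Polynomial.C_mul]; ring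
  have h2 : (1 + Polynomial.C (X i ^ ℓ) * Polynomial.X : Polynomial (MvPolynomial ι ℤ)) =
      ((1 + Polynomial.X : Polynomial (MvPolynomial ι ℤ))).comp
        (Polynomial.C (X i ^ ℓ) * Polynomial.X) := by simp
  rw [h1, mul_pow, h2, ← Polynomial.pow_comp, ← Polynomial.C_pow, Polynomial.coeff_C_mul,
    Polynomial.comp_C_mul_X_coeff, Polynomial.coeff_one_add_X_pow, pow_add, mul_comm g ℓ, pow_mul]
  ring

lemma pe_homog (ℓ h g : ℕ) : ((pe ι ℓ h).coeff g).IsHomogeneous (h + g * ℓ) := by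
  have hprod : ∀ (t : Finset ι) (g : ℕ),
      ((∏ i ∈ t, pw ι ℓ i).coeff g).IsHomogeneous (t.card + g * ℓ) := by
    intro t
    induction t using Finset.induction_on with
    | empty =>
      intro g
      rw [Finset.prod_empty, Polynomial.coeff_one]
      split_ifs with hg
      · subst hg; simpa using isHomogeneous_one ι ℤ
      · exact isHomogeneous_zero _ _ _
    | insert i t hi ih =>
      intro g
      rw [Finset.prod_insert hi, Polynomial.coeff_mul, Finset.card_insert_of_notMem hi]
      apply IsHomogeneous.sum
      rintro ⟨a, b⟩ hab
      rw [Finset.HasAntidiagonal.mem_antidiagonal] at hab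
      simp only at hab ⊢
      have h1 : ((pw ι ℓ i).coeff a).IsHomogeneous (1 + a * ℓ) := by
        have h0 := pw_pow_coeff ℓ 1 a i
        rw [pow_one] at h0
        have h2 := (isHomogeneous_C ι ((Nat.choose 1 a : ℕ) : ℤ)).mul
          (isHomogeneous_X_pow (R := ℤ) i (1 + a * ℓ))
        rw [zero_add, map_natCast] at h2
        rw [h0]
        exact h2
      convert h1.mul (ih b) using 1
      rw [← hab]; ring
  rw [pe, esymm, map_sum, Polynomial.finsetSum_coeff]
  apply IsHomogeneous.sum
  intro t ht
  rw [Finset.mem_powersetCard] at ht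
  rw [map_prod]
  simp only [aeval_X]
  rw [← ht.2]
  exact hprod t g

lemma pe_sum_InJ {n q : ℕ} (hn : Fintype.card ι = n) (ℓ h : ℕ) (δ : ι → Polynomial (MvPolynomial ι ℤ))
    (hδ : ∀ k g, InJ ι n q ((∑ i, pw ι ℓ i ^ k * δ i).coeff g)) (g : ℕ) :
    InJ ι n q ((∑ i, aeval (pw ι ℓ) (pderiv i (esymm ι ℤ h)) * δ i).coeff g) := by
  have h1 : (∑ i, aeval (pw ι ℓ) (pderiv i (esymm ι ℤ h)) * δ i) =
      ∑ k ∈ Finset.range h, (Polynomial.C ((-1) ^ k) * pe ι ℓ (h - 1 - k)) *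
        ∑ i, pw ι ℓ i ^ k * δ i := by
    simp_rw [pderiv_esymm, map_sum, Finset.sum_mul, Finset.mul_sum]
    rw [Finset.sum_comm]
    refine Finset.sum_congr rfl fun k _ => Finset.sum_congr rfl fun i _ => ?_
    simp [pe, mul_assoc]
  rw [h1, Polynomial.finsetSum_coeff]
  apply InJ.sum
  intro k _
  rw [Polynomial.coeff_mul]
  apply InJ.sum
  rintro ⟨a, b⟩ _
  rw [Polynomial.coeff_C_mul]
  exact InJ.mul ((InR.sign _).mul (evE_surj hn _ (pe_symm _ _ _))) (hδ _ _)

lemma h_mul_pe {n q : ℕ} (hn : Fintype.card ι = n) (ℓ h g : ℕ) :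
    InJ ι n q ((h : MvPolynomial ι ℤ) * (pe ι ℓ h).coeff g) := by
  have h1 := (esymm_isHomog (ι := ι) h).sum_X_mul_pderiv
  have h2 := pe_sum_InJ (q := q) hn ℓ h (pw ι ℓ) (by
    intro k g
    simp_rw [← pow_succ]
    rw [Polynomial.finsetSum_coeff]
    simp_rw [pw_pow_coeff, ← Finset.mul_sum]
    exact InJ.mul (InR.nat _) (InJ.psum hn _ (by omega))) g
  convert h2 using 1
  have h3 := congrArg (aeval (pw ι ℓ)) h1
  rw [map_sum] at h3
  simp only [map_mul, aeval_X, nsmul_eq_mul, map_natCast] at h3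
  simp_rw [mul_comm _ (pw ι ℓ _)]
  rw [h3, Polynomial.coeff_natCast_mul, pe]

lemma derivative_aeval_pw (ℓ : ℕ) (F : MvPolynomial ι ℤ) :
    Polynomial.derivative (aeval (pw ι ℓ) F) =
        ∑ i, aeval (pw ι ℓ) (pderiv i F) * Polynomial.C (X i ^ (ℓ + 1)) := by
  induction F using MvPolynomial.induction_on with
  | C a => simp
  | add p q hp hq => simp only [map_add, hp, hq, add_mul, Finset.sum_add_distrib]
  | mul_X p i hp =>
    have h1 : ∀ j, aeval (pw ι ℓ) (pderiv j (p * X i)) =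
        aeval (pw ι ℓ) (pderiv j p) * pw ι ℓ i +
          (if i = j then aeval (pw ι ℓ) p else 0) := by
      intro j
      rw [pderiv_mul, map_add, map_mul, map_mul, aeval_X]
      congr 1
      split_ifs with h
      · subst h; rw [pderiv_X_self, map_one, mul_one]
      · rw [pderiv_X_of_ne h, map_zero, mul_zero]
    have h2 : Polynomial.derivative (pw ι ℓ i) = Polynomial.C (X i ^ (ℓ + 1)) := by
      rw [pw, Polynomial.derivative_add, Polynomial.derivative_C, Polynomial.derivative_mul,
        Polynomial.derivative_C, Polynomial.derivative_X]
      ring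
    simp_rw [h1, add_mul, Finset.sum_add_distrib, ite_mul, zero_mul]
    rw [Finset.sum_ite_eq, if_pos (Finset.mem_univ _), map_mul, Polynomial.derivative_mul, hp,
      aeval_X, h2, Finset.sum_mul]
    exact congrArg₂ (· + ·) (Finset.sum_congr rfl fun j _ => mul_right_comm _ _ _) rfl

lemma g_mul_pe {n q : ℕ} (hn : Fintype.card ι = n) (ℓ h g : ℕ) :
    InJ ι n q ((g : MvPolynomial ι ℤ) * (pe ι ℓ h).coeff g) := by
  rcases g with _ | g
  · exact ⟨0, by simp, by simp⟩
  have h2 := pe_sum_InJ (q := q) hn ℓ h (fun i => Polynomial.C (X i ^ (ℓ + 1))) (by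
    intro k g
    rw [Polynomial.finsetSum_coeff]
    simp_rw [Polynomial.coeff_mul_C, pw_pow_coeff, mul_assoc, ← pow_add, ← Finset.mul_sum]
    exact InJ.mul (InR.nat _) (InJ.psum hn _ (by omega))) g
  have h3 : Polynomial.derivative (pe ι ℓ h) =
      ∑ i, aeval (pw ι ℓ) (pderiv i (esymm ι ℤ h)) * Polynomial.C (X i ^ (ℓ + 1)) := by
    exact derivative_aeval_pw ℓ _
  rw [← h3, Polynomial.coeff_derivative] at h2
  convert h2 using 1
  push_cast
  ring

/-- Main universal statement. -/
lemma universal (n : ℕ) (hn : Fintype.card ι = n) (ℓ h g : ℕ) :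
    ∃ D : MvPolynomial (Fin n) ℤ, evE ι n D = (pe ι ℓ h).coeff g ∧
      D.IsWeightedHomogeneous (fun i : Fin n => (i : ℕ) + 1) (h + g * ℓ) ∧
      ∀ (q : ℕ) (d : Fin n →₀ ℕ), (∀ i ∈ d.support, q ∣ (i : ℕ) + 1) →
        (q : ℤ) ∣ g * coeff d D ∧ (q : ℤ) ∣ h * coeff d D := by
  obtain ⟨D, hD⟩ := evE_surj hn _ (pe_symm (ι := ι) ℓ h g)
  refine ⟨D, hD, evE_isWH hn _ _ (hD ▸ pe_homog ℓ h g), ?_⟩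
  intro q d hd
  have aux : ∀ m : ℕ, InJ ι n q ((m : MvPolynomial ι ℤ) * (pe ι ℓ h).coeff g) →
      (q : ℤ) ∣ m * coeff d D := by
    rintro m ⟨E, hE, hE0⟩
    have : E = m * D := evE_injective hn (by rw [hE, map_mul, hD, map_natCast])
    rw [this] at hE0
    have h1 := killE_coeff n q (m * D) d hd
    rw [hE0, coeff_zero] at h1
    have h2 : (m : MvPolynomial (Fin n) ℤ) = C (m : ℤ) := by simp
    rw [h2, coeff_C_mul] at h1
    exact (ZMod.intCast_zmod_eq_zero_iff_dvd _ q).1 h1.symm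
  exact ⟨aux g (g_mul_pe hn ℓ h g), aux h (h_mul_pe hn ℓ h g)⟩

lemma pe_coeff_zero (ℓ h : ℕ) : (pe ι ℓ h).coeff 0 = esymm ι ℤ h := by
  rw [Polynomial.coeff_zero_eq_aeval_zero, pe, esymm, map_sum, map_sum]
  refine Finset.sum_congr rfl fun t _ => ?_
  rw [map_prod, map_prod]
  refine Finset.prod_congr rfl fun i _ => ?_
  simp [pw]

lemma pe_eval {E : Type*} [Field E] (x : ι → E) (r : E) (ℓ h : ℕ) :
    aeval (fun i => x i + r * x i ^ (ℓ + 1)) (esymm ι ℤ h) =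
      Polynomial.eval₂ ((aeval x : MvPolynomial ι ℤ →ₐ[ℤ] E) : MvPolynomial ι ℤ →+* E) r
        (pe ι ℓ h) := by
  rw [← Polynomial.coe_eval₂RingHom, pe, esymm, map_sum, map_sum, map_sum]
  refine Finset.sum_congr rfl fun t _ => ?_
  rw [map_prod, map_prod, map_prod]
  refine Finset.prod_congr rfl fun i _ => ?_
  rw [aeval_X, aeval_X, pw, Polynomial.coe_eval₂RingHom, Polynomial.eval₂_add,
    Polynomial.eval₂_mul, Polynomial.eval₂_C, Polynomial.eval₂_C, Polynomial.eval₂_X]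
  simp

end UniversalPart

section ValuationPart

/-- bundled valuation -/
def IsDiscreteValuationOn.toAdd {F : Type*} [Field F] {v : F → WithTop ℤ}
    (hv : IsDiscreteValuationOn v) : AddValuation F (WithTop ℤ) :=
  AddValuation.of v ((hv.eq_top_iff 0).2 rfl) (by
    have h1 := hv.map_mul 1 1
    have h2 : v 1 ≠ ⊤ := fun h => one_ne_zero ((hv.eq_top_iff 1).1 h)
    rw [mul_one] at h1
    cases h : v 1 with
    | top => exact absurd h h2
    | coe a =>
      rw [h] at h1
      have : a = a + a := by exact_mod_cast h1
      have : a = 0 := by omega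
      rw [this]; rfl) hv.min_le_add hv.map_mul

lemma IsDiscreteValuationOn.toAdd_apply {F : Type*} [Field F] {v : F → WithTop ℤ}
    (hv : IsDiscreteValuationOn v) (x : F) : hv.toAdd x = v x := rfl

lemma val_sum_le {F α : Type*} [Field F] (v : AddValuation F (WithTop ℤ)) (s : Finset α)
    (f : α → F) (hd : ∀ i ∈ s, ∀ j ∈ s, i ≠ j → v (f i) ≠ ⊤ → v (f i) ≠ v (f j)) :
    ∀ i ∈ s, v (∑ i ∈ s, f i) ≤ v (f i) := by
  intro i hi
  obtain ⟨m, hm, hmin⟩ := Finset.exists_min_image s (fun i => v (f i)) ⟨i, hi⟩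
  by_cases ht : v (f m) = ⊤
  · have := hmin i hi
    rw [ht, top_le_iff] at this
    rw [this]; exact le_top
  · have hlt : v (f m) < v (∑ j ∈ s.erase m, f j) := by
      apply v.map_lt_sum ht
      intro j hj
      rw [Finset.mem_erase] at hj
      exact lt_of_le_of_ne (hmin j hj.2) (hd m hm j hj.2 hj.1.symm ht)
    rw [← Finset.add_sum_erase s f hm, v.map_add_eq_of_lt_left hlt]
    exact hmin i hi

lemma eisenstein {K L : Type*} [Field K] [Field L] [Algebra K L]
    [FiniteDimensional K L] (n : ℕ) (hdim : Module.finrank K L = n)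
    (vK : K → WithTop ℤ) (vL : L → WithTop ℤ)
    (hvK : IsDiscreteValuationOn vK) (hvL : IsDiscreteValuationOn vL)
    (htotram : ∀ x : K, vL (algebraMap K L x) = n • vK x)
    (π : L) (hπ : vL π = 1) :
    (minpoly K π).natDegree = n ∧ ∀ i < n, 1 ≤ vK ((minpoly K π).coeff i) := by
  have hn0 : 0 < n := hdim ▸ Module.finrank_pos
  have hint : IsIntegral K π := IsIntegral.of_finite K π
  have hpow : ∀ i : ℕ, vL (π ^ i) = ((i : ℤ) : WithTop ℤ) := by
    intro i
    rw [← hvL.toAdd_apply, AddValuation.map_pow, hvL.toAdd_apply, hπ]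
    simp
  have hterm : ∀ (a : K) (i : ℕ) (b : ℤ), vK a = b →
      vL (algebraMap K L a * π ^ i) = ((n * b + i : ℤ) : WithTop ℤ) := by
    intro a i b hb
    rw [hvL.map_mul, htotram, hpow, hb, ← WithTop.coe_nsmul, ← WithTop.coe_add]
    simp
  have hle : ∀ (a : ℕ → K) (m : ℕ), m ≤ n → ∀ i ∈ Finset.range m,
      vL (∑ i ∈ Finset.range m, algebraMap K L (a i) * π ^ i) ≤ vL (algebraMap K L (a i) * π ^ i) := by
    intro a m hm
    apply val_sum_le hvL.toAdd
    intro i hi j hj hij hit heq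
    rw [Finset.mem_range] at hi hj
    rw [hvL.toAdd_apply] at hit
    rw [hvL.toAdd_apply, hvL.toAdd_apply] at heq
    have hai : vK (a i) ≠ ⊤ := by
      intro h
      apply hit
      rw [(hvK.eq_top_iff _).1 h, hvL.eq_top_iff]; simp
    have haj : vK (a j) ≠ ⊤ := by
      intro h
      apply hit
      rw [heq, (hvK.eq_top_iff _).1 h, hvL.eq_top_iff]; simp
    obtain ⟨b, hb⟩ := WithTop.ne_top_iff_exists.1 hai
    obtain ⟨c, hc⟩ := WithTop.ne_top_iff_exists.1 haj
    rw [hterm _ _ b hb.symm, hterm _ _ c hc.symm, WithTop.coe_inj] at heq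
    have h1 : ((n : ℤ) * b + i) % n = ((n : ℤ) * c + j) % n := by rw [heq]
    rw [Int.mul_add_emod_self_left, Int.mul_add_emod_self_left,
      Int.emod_eq_of_lt (by omega) (by omega), Int.emod_eq_of_lt (by omega) (by omega)] at h1
    omega
  have hsum : ∑ i ∈ Finset.range ((minpoly K π).natDegree + 1),
      algebraMap K L ((minpoly K π).coeff i) * π ^ i = 0 := by
    have := minpoly.aeval K π
    rw [Polynomial.aeval_eq_sum_range] at this
    simpa only [Algebra.smul_def] using this
  have hmonic := minpoly.monic hint
  have hdeg : (minpoly K π).natDegree = n := by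
    apply le_antisymm (hdim ▸ minpoly.natDegree_le π)
    by_contra hlt
    push Not at hlt
    have := hle (minpoly K π).coeff _ (Nat.succ_le_of_lt hlt) _ (Finset.self_mem_range_succ _)
    rw [hsum, (hvL.eq_top_iff 0).2 rfl, top_le_iff, hvL.eq_top_iff, hmonic.coeff_natDegree,
      map_one, one_mul] at this
    have h2 := hpow (minpoly K π).natDegree
    rw [this, (hvL.eq_top_iff 0).2 rfl] at h2
    exact WithTop.coe_ne_top h2.symm
  refine ⟨hdeg, ?_⟩
  intro i hi
  rw [hdeg, Finset.sum_range_succ, ← hdeg, hmonic.coeff_natDegree, hdeg, map_one, one_mul] at hsum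
  have h1 := hle (minpoly K π).coeff n le_rfl i (Finset.mem_range.2 hi)
  rw [eq_neg_of_add_eq_zero_left hsum, ← hvL.toAdd_apply, AddValuation.map_neg, hvL.toAdd_apply,
    hpow] at h1
  cases hb : vK ((minpoly K π).coeff i) with
  | top => exact le_top
  | coe b =>
    rw [hterm _ _ b hb, WithTop.coe_le_coe] at h1
    have : 1 ≤ b := by
      by_contra hb'
      have : (n : ℤ) * b ≤ 0 := mul_nonpos_of_nonneg_of_nonpos (by omega) (by omega)
      omega
    exact_mod_cast this

lemma minpolyCoeff_eq {K L : Type*} [Field K] [Field L] [Algebra K L]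
    (E : Type*) [Field E] [Algebra K E] [IsAlgClosed E]
    [FiniteDimensional K L] [Algebra.IsSeparable K L] (n : ℕ) (hdim : Module.finrank K L = n)
    (x : L) (hx : (minpoly K x).natDegree = n) (h : ℕ) (hh : h ≤ n) :
    algebraMap K E (minpolyCoeff K n x h) =
      MvPolynomial.aeval (fun σ : L →ₐ[K] E => σ x)
        (MvPolynomial.esymm (L →ₐ[K] E) ℤ h) := by
  have hint : IsIntegral K x := IsIntegral.of_finite K x
  have hcard : Fintype.card (L →ₐ[K] E) = n := by
    rw [AlgHom.card, hdim]
  have hinj : Function.Injective fun σ : L →ₐ[K] E => σ x :=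
    (Field.primitive_element_iff_algHom_eq_of_eval' K E
      (fun y => IsAlgClosed.splits _) x).1
      ((Field.primitive_element_iff_minpoly_natDegree_eq K x).2 (hx.trans hdim.symm))
  set s : Multiset E :=
    (Finset.univ : Finset (L →ₐ[K] E)).val.map (fun σ => σ x) with hs
  have hscard : Multiset.card s = n := by rw [hs, Multiset.card_map]; exact hcard
  have hnodup : s.Nodup := Multiset.Nodup.map hinj Finset.univ.nodup
  have hmonic := (minpoly.monic hint).map (algebraMap K E)
  have hprod : (s.map fun a => Polynomial.X - Polynomial.C a).prod =
      (minpoly K x).map (algebraMap K E) := by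
    symm
    apply Polynomial.eq_of_monic_of_dvd_of_natDegree_le
      (Polynomial.monic_multiset_prod_of_monic _ _ fun a _ => Polynomial.monic_X_sub_C a) hmonic
    · rw [Multiset.prod_X_sub_C_dvd_iff_le_roots hmonic.ne_zero, Multiset.le_iff_subset hnodup]
      intro a ha
      rw [hs, Multiset.mem_map] at ha
      obtain ⟨σ, _, rfl⟩ := ha
      rw [Polynomial.mem_roots hmonic.ne_zero, Polynomial.IsRoot, Polynomial.eval_map_algebraMap,
        Polynomial.aeval_algHom_apply, minpoly.aeval, map_zero]
    · rw [Polynomial.natDegree_map, hx, Polynomial.natDegree_multiset_prod_X_sub_C_eq_card, hscard]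
  rw [MvPolynomial.aeval_esymm_eq_multiset_esymm, minpolyCoeff, map_mul, ← Polynomial.coeff_map,
    ← hprod, Multiset.prod_X_sub_C_coeff _ (by omega), hscard, show n - (n - h) = h by omega,
    ← mul_assoc, map_pow, map_neg, map_one, ← mul_pow]
  simp [hs]

lemma diff_expansion {K L : Type*} [Field K] [Field L] [Algebra K L]
    (E : Type*) [Field E] [Algebra K E] [IsAlgClosed E]
    [FiniteDimensional K L] [Algebra.IsSeparable K L] (n : ℕ) (hdim : Module.finrank K L = n)
    (π πt : L) (r : K) (ℓ : ℕ) (hπt : πt = π + algebraMap K L r * π ^ (ℓ + 1))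
    (hdeg : (minpoly K π).natDegree = n) (hdegt : (minpoly K πt).natDegree = n)
    (h : ℕ) (hhn : h ≤ n) :
    ∃ (N : ℕ) (D : ℕ → MvPolynomial (Fin n) ℤ),
      (∀ g, (D g).IsWeightedHomogeneous (fun i : Fin n => (i : ℕ) + 1) (h + g * ℓ)) ∧
      (∀ (g q : ℕ) (d : Fin n →₀ ℕ), (∀ i ∈ d.support, q ∣ (i : ℕ) + 1) →
        (q : ℤ) ∣ g * MvPolynomial.coeff d (D g) ∧ (q : ℤ) ∣ h * MvPolynomial.coeff d (D g)) ∧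
      minpolyCoeff K n πt h - minpolyCoeff K n π h =
      ∑ g ∈ Finset.range N, r ^ (g + 1) *
        MvPolynomial.aeval (fun i : Fin n => minpolyCoeff K n π ((i : ℕ) + 1)) (D (g + 1)) := by
  have hcard : Fintype.card (L →ₐ[K] E) = n := by
    rw [AlgHom.card, hdim]
  choose D hD1 hD2 hD3 using fun g => universal (ι := L →ₐ[K] E) n hcard ℓ h g
  set N := (pe (L →ₐ[K] E) ℓ h).natDegree with hN
  have hdiff : minpolyCoeff K n πt h - minpolyCoeff K n π h =
      ∑ g ∈ Finset.range N, r ^ (g + 1) *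
        MvPolynomial.aeval (fun i : Fin n => minpolyCoeff K n π ((i : ℕ) + 1)) (D (g + 1)) := by
    apply (algebraMap K E).injective
    have hx : (fun σ : L →ₐ[K] E => σ πt) =
        fun σ => σ π + algebraMap K E r * (σ π) ^ (ℓ + 1) := by
      funext σ
      rw [hπt]; simp
    rw [map_sub, minpolyCoeff_eq E n hdim πt hdegt h hhn, minpolyCoeff_eq E n hdim π hdeg h hhn, hx,
      pe_eval (fun σ : L →ₐ[K] E => σ π), Polynomial.eval₂_eq_sum_range,
      Finset.sum_range_succ', pe_coeff_zero, pow_zero, mul_one, RingHom.coe_coe,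
      add_sub_cancel_right, map_sum]
    refine Finset.sum_congr rfl fun g _ => ?_
    rw [map_mul, map_pow, mul_comm, ← hD1 (g + 1), evE,
      ← MvPolynomial.aeval_algebraMap_apply]
    congr 1
    rw [← AlgHom.comp_apply, MvPolynomial.comp_aeval]
    congr 2
    funext i
    exact (minpolyCoeff_eq E n hdim π hdeg _ (by omega)).symm
  exact ⟨N, D, hD2, hD3, hdiff⟩

lemma val_prod_ge {F α : Type*} [Field F] (v : AddValuation F (WithTop ℤ)) (s : Finset α)
    (f : α → F) (w : α → ℕ) (hw : ∀ i ∈ s, ((w i : ℤ) : WithTop ℤ) ≤ v (f i)) :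
    (((∑ i ∈ s, w i : ℕ) : ℤ) : WithTop ℤ) ≤ v (∏ i ∈ s, f i) := by
  induction s using Finset.induction_on with
  | empty => simp
  | insert a s ha ih =>
    rw [Finset.sum_insert ha, Finset.prod_insert ha, v.map_mul, Nat.cast_add, WithTop.coe_add]
    exact add_le_add (hw a (Finset.mem_insert_self _ _))
      (ih fun i hi => hw i (Finset.mem_insert_of_mem hi))

lemma val_pow_ge {F : Type*} [Field F] (v : AddValuation F (WithTop ℤ)) (x : F) (w k : ℕ)
    (hw : ((w : ℤ) : WithTop ℤ) ≤ v x) : (((k * w : ℕ) : ℤ) : WithTop ℤ) ≤ v (x ^ k) := by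
  have := val_prod_ge v (Finset.range k) (fun _ => x) (fun _ => w) (fun _ _ => hw)
  simpa using this

lemma val_nat_nonneg {F : Type*} [Field F] (v : AddValuation F (WithTop ℤ)) (m : ℕ) :
    0 ≤ v (m : F) := by
  induction m with
  | zero => simp
  | succ m ih =>
    rw [Nat.cast_succ]
    exact le_trans (le_min ih (by simp)) (v.map_add _ _)

lemma val_int_nonneg {F : Type*} [Field F] (v : AddValuation F (WithTop ℤ)) (m : ℤ) :
    0 ≤ v (m : F) := by
  obtain ⟨k, rfl | rfl⟩ := m.eq_nat_or_neg
  · simpa using val_nat_nonneg v k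
  · simpa using val_nat_nonneg v k

lemma val_int_ge {F : Type*} [Field F] (v : AddValuation F (WithTop ℤ)) (p k : ℕ) (m : ℤ)
    (hm : ((p ^ k : ℕ) : ℤ) ∣ m) : k • v (p : F) ≤ v (m : F) := by
  obtain ⟨t, rfl⟩ := hm
  push_cast
  rw [v.map_mul, v.map_pow]
  exact le_add_of_nonneg_right (val_int_nonneg v t)

/-- The monomial bound. -/
lemma val_monomial_ge {F : Type*} [Field F] (v : AddValuation F (WithTop ℤ)) (n : ℕ)
    (c : Fin n → F) (hc : ∀ i : Fin n, ((((i : ℕ) + 1 : ℕ) : ℤ) : WithTop ℤ) ≤ v (c i))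
    (d : Fin n →₀ ℕ) (i0 : Fin n) (hi0 : i0 ∈ d.support) (I : WithTop ℤ)
    (hI : I + ((((i0 : ℕ) + 1 : ℕ) : ℤ) : WithTop ℤ) ≤ v (c i0)) :
    I + (((Finsupp.weight (fun i : Fin n => (i : ℕ) + 1) d : ℕ) : ℤ) : WithTop ℤ) ≤
      v (∏ i ∈ d.support, c i ^ d i) := by
  rw [Finsupp.weight_apply, Finsupp.sum, ← Finset.add_sum_erase _ _ hi0,
    ← Finset.mul_prod_erase _ _ hi0, v.map_mul, Nat.cast_add, WithTop.coe_add, ← add_assoc]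
  refine add_le_add ?_ ?_
  · obtain ⟨k, hk⟩ := Nat.exists_eq_succ_of_ne_zero (Finsupp.mem_support_iff.1 hi0)
    rw [hk, pow_succ', v.map_mul, Nat.succ_eq_add_one, add_comm k 1, add_smul, one_smul,
      Nat.cast_add, WithTop.coe_add, ← add_assoc]
    exact add_le_add hI (val_pow_ge v _ _ _ (hc i0))
  · exact val_prod_ge v (d.support.erase i0) (fun i => c i ^ d i)
      (fun i => d i • ((i : ℕ) + 1)) fun i _ => val_pow_ge v _ _ _ (hc i)

lemma nsmul_top_aux (n : ℕ) (hn0 : 0 < n) : n • (⊤ : WithTop ℤ) = ⊤ := by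
  obtain ⟨k, rfl⟩ := Nat.exists_eq_succ_of_ne_zero hn0.ne'
  rw [succ_nsmul, add_top]

lemma final_bound {K L : Type*} [Field K] [Field L] [Algebra K L]
    (p ν n : ℕ) (hp : p.Prime)
    (vK : K → WithTop ℤ) (v : AddValuation L (WithTop ℤ))
    (htotram : ∀ x : K, v (algebraMap K L x) = n • vK x) (hn0 : 0 < n)
    (c : ℕ → K) (hc : ∀ i, 1 ≤ i → i ≤ n → 1 ≤ vK (c i))
    (ℓ h g : ℕ) (hh1 : 1 ≤ h) (hg1 : 1 ≤ g)
    (D : MvPolynomial (Fin n) ℤ)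
    (hw : D.IsWeightedHomogeneous (fun i : Fin n => (i : ℕ) + 1) (h + g * ℓ))
    (hD : ∀ (q : ℕ) (d : Fin n →₀ ℕ), (∀ i ∈ d.support, q ∣ (i : ℕ) + 1) →
        (q : ℤ) ∣ g * MvPolynomial.coeff d D ∧ (q : ℤ) ∣ h * MvPolynomial.coeff d D) :
    phiIdx vK p ν n (v (p : L)) c (vbar p ν h) ℓ + ((h : ℤ) : WithTop ℤ) ≤
      v (algebraMap K L (MvPolynomial.aeval (fun i : Fin n => c ((i : ℕ) + 1)) D)) := by
  have : Fact p.Prime := ⟨hp⟩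
  rw [← MvPolynomial.aeval_algebraMap_apply, MvPolynomial.aeval_def, MvPolynomial.eval₂_eq]
  apply v.map_le_sum
  intro d hd
  have hwd := hw (MvPolynomial.mem_support_iff.1 hd)
  have hne : d.support.Nonempty := by
    rw [Finsupp.support_nonempty_iff]
    rintro rfl
    simp at hwd
    omega
  obtain ⟨i0, hi0, hmin⟩ := Finset.exists_min_image d.support
    (fun i => vbar p ν ((i : ℕ) + 1)) hne
  set j' := vbar p ν ((i0 : ℕ) + 1) with hj'
  have hj'ν : j' ≤ ν := min_le_right _ _
  have hdvd : ∀ i ∈ d.support, p ^ j' ∣ (i : ℕ) + 1 := by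
    intro i hi
    rw [padicValNat_dvd_iff_le (by omega)]
    exact (hmin i hi).trans (min_le_left _ _)
  have hcL : ∀ i : Fin n, ((((i : ℕ) + 1 : ℕ) : ℤ) : WithTop ℤ) ≤
      v ((algebraMap K L ∘ fun i : Fin n => c ((i : ℕ) + 1)) i) := by
    intro i
    have h1 := hc ((i : ℕ) + 1) (by omega) (by omega)
    simp only [Function.comp]
    rw [htotram]
    cases hb : vK (c ((i : ℕ) + 1)) with
    | top => rw [nsmul_top_aux n hn0]; exact le_top
    | coe b =>
      rw [hb] at h1
      have h1 : 1 ≤ b := by exact_mod_cast h1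
      rw [← WithTop.coe_nsmul, WithTop.coe_le_coe, nsmul_eq_mul]
      have h2 : (((i : ℕ) + 1 : ℕ) : ℤ) ≤ n := by have := i.2; omega
      nlinarith
  have hI : iPi vK p ν n c j' + ((((i0 : ℕ) + 1 : ℕ) : ℤ) : WithTop ℤ) ≤
      v ((algebraMap K L ∘ fun i : Fin n => c ((i : ℕ) + 1)) i0) := by
    have h1 : iPi vK p ν n c j' ≤ (vK (c ((i0 : ℕ) + 1))).map
        fun a => (n : ℤ) * a - (((i0 : ℕ) + 1 : ℕ) : ℤ) :=
      Finset.inf_le (f := fun h : ℕ => (vK (c h)).map fun a => (n : ℤ) * a - (h : ℤ))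
        (Finset.mem_filter.2 ⟨Finset.mem_Icc.2 ⟨by omega, by omega⟩, le_rfl⟩)
    refine (add_le_add_left h1 _).trans ?_
    simp only [Function.comp]
    rw [htotram]
    cases hb : vK (c ((i0 : ℕ) + 1)) with
    | top => rw [nsmul_top_aux n hn0]; exact le_top
    | coe b =>
      rw [WithTop.map_coe, ← WithTop.coe_nsmul, ← WithTop.coe_add, WithTop.coe_le_coe, nsmul_eq_mul]
      omega
  have hmon := val_monomial_ge v n _ hcL d i0 hi0 _ hI
  rw [hwd] at hmon
  have hphi : ∀ j0 ≤ vbar p ν h, phiIdx vK p ν n (v (p : L)) c (vbar p ν h) ℓ ≤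
      insepIdx vK p ν n (v (p : L)) c j0 + (((p ^ j0 * ℓ : ℕ) : ℤ) : WithTop ℤ) := fun j0 hj0 =>
    Finset.inf_le (f := fun j0 => phiTilde vK p ν n (v (p : L)) c j0 ℓ)
      (Finset.mem_Icc.2 ⟨Nat.zero_le _, hj0⟩)
  have hins : ∀ j0 ≤ j', insepIdx vK p ν n (v (p : L)) c j0 ≤
      iPi vK p ν n c j' + (j' - j0) • v (p : L) := fun j0 hj0 =>
    Finset.inf_le (f := fun j' => iPi vK p ν n c j' + (j' - j0) • v (p : L))
      (Finset.mem_Icc.2 ⟨hj0, hj'ν⟩)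
  have key : ∃ j0, j0 ≤ vbar p ν h ∧ j0 ≤ j' ∧ p ^ j0 ≤ g ∧
      ((p ^ (j' - j0) : ℕ) : ℤ) ∣ MvPolynomial.coeff d D := by
    have hpg : p ^ padicValNat p g ≤ g := Nat.le_of_dvd hg1 pow_padicValNat_dvd
    obtain ⟨hDg, hDh⟩ := hD (p ^ j') d hdvd
    have hcancel : ∀ m : ℕ, m ≠ 0 → ((p ^ j' : ℕ) : ℤ) ∣ m * MvPolynomial.coeff d D →
        ((p ^ (j' - padicValNat p m) : ℕ) : ℤ) ∣ MvPolynomial.coeff d D := by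
      intro m hm0 hm
      rw [Int.natCast_dvd, Int.natAbs_mul, Int.natAbs_natCast] at hm
      rw [Int.natCast_dvd]
      by_cases h0 : (MvPolynomial.coeff d D).natAbs = 0
      · rw [h0]; exact dvd_zero _
      · rw [padicValNat_dvd_iff_le (mul_ne_zero hm0 h0), padicValNat.mul hm0 h0] at hm
        rw [padicValNat_dvd_iff_le h0]
        omega
    by_cases hle : j' ≤ min (padicValNat p g) (vbar p ν h)
    · refine ⟨j', hle.trans (min_le_right _ _), le_rfl, ?_, by simp⟩
      exact (Nat.pow_le_pow_right hp.pos (hle.trans (min_le_left _ _))).trans hpg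
    · rcases le_total (padicValNat p g) (vbar p ν h) with h1 | h1
      · rw [min_eq_left h1] at hle
        exact ⟨padicValNat p g, h1, by omega, hpg, hcancel g (by omega) hDg⟩
      · rw [min_eq_right h1] at hle
        have h2 : vbar p ν h = padicValNat p h := by
          unfold vbar at hle ⊢
          omega
        refine ⟨vbar p ν h, le_rfl, by omega,
          (Nat.pow_le_pow_right hp.pos h1).trans hpg, ?_⟩
        rw [h2]
        exact hcancel h (by omega) hDh
  obtain ⟨j0, hj0h, hj0j', hpg, hcoef⟩ := key
  rw [v.map_mul]
  have hval : (j' - j0) • v (p : L) ≤ v (algebraMap ℤ L (MvPolynomial.coeff d D)) := by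
    simpa using val_int_ge v p _ _ hcoef
  have hnum : (((p ^ j0 * ℓ : ℕ) : ℤ) : WithTop ℤ) + ((h : ℤ) : WithTop ℤ) ≤
      (((h + g * ℓ : ℕ) : ℤ) : WithTop ℤ) := by
    rw [← WithTop.coe_add, WithTop.coe_le_coe]
    have := Nat.mul_le_mul_right ℓ hpg
    push_cast at this ⊢
    have : (p : ℤ) ^ j0 * ℓ ≤ g * ℓ := by exact_mod_cast this
    omega
  calc phiIdx vK p ν n (v (p : L)) c (vbar p ν h) ℓ + ((h : ℤ) : WithTop ℤ)
      ≤ (iPi vK p ν n c j' + (j' - j0) • v (p : L) + (((p ^ j0 * ℓ : ℕ) : ℤ) : WithTop ℤ)) +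
          ((h : ℤ) : WithTop ℤ) :=
        add_le_add_left ((hphi j0 hj0h).trans (add_le_add_left (hins j0 hj0j') _)) _
    _ = (j' - j0) • v (p : L) + (iPi vK p ν n c j' +
          ((((p ^ j0 * ℓ : ℕ) : ℤ) : WithTop ℤ) + ((h : ℤ) : WithTop ℤ))) := by
        rw [add_comm (iPi vK p ν n c j'), add_assoc, add_assoc]
    _ ≤ _ := add_le_add hval ((add_le_add_right hnum _).trans hmon)

lemma ceil_le (n h : ℕ) (hn0 : 0 < n) (φ x : WithTop ℤ)
    (hle : φ + ((h : ℤ) : WithTop ℤ) ≤ n • x) :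
    (φ.map fun a : ℤ => (⌈((a : ℚ) + (h : ℚ)) / (n : ℚ)⌉ : ℤ)) ≤ x := by
  cases x with
  | top => exact le_top
  | coe b =>
    cases φ with
    | top => rw [top_add, top_le_iff, ← WithTop.coe_nsmul] at hle; exact absurd hle WithTop.coe_ne_top
    | coe a =>
      rw [← WithTop.coe_nsmul, ← WithTop.coe_add, WithTop.coe_le_coe, nsmul_eq_mul] at hle
      rw [WithTop.map_coe, WithTop.coe_le_coe, Int.ceil_le,
        div_le_iff₀ (by exact_mod_cast hn0), mul_comm]
      exact_mod_cast hle

end ValuationPart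

/-- Let `π_L` be a uniformizer of the totally ramified separable extension `L/K` of
degree `n = u·p^ν`, with minimal polynomial `f(X) = X^n - c_1 X^{n-1} + ⋯ + (-1)^n c_n`
over `K`.  Let `ℓ ≥ 1`, `r ∈ O_K`, and `π̃_L = π_L + r·π_L^{ℓ+1}`, with minimal
polynomial `f̃(X) = X^n - c̃_1 X^{n-1} + ⋯ + (-1)^n c̃_n` over `K`.  Then for all
`1 ≤ h ≤ n` one has `c̃_h ≡ c_h (mod M_K^{ρ_h(ℓ)})`, where
`ρ_h(ℓ) = ⌈(φ_j(ℓ) + h)/n⌉` with `j = v̄_p(h)`. -/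
theorem nochange_perturb {K L : Type*} [Field K] [Field L] [Algebra K L]
    [FiniteDimensional K L] [Algebra.IsSeparable K L]
    (p u ν n : ℕ) (hp : p.Prime) (hu : ¬ p ∣ u) (hn : n = u * p ^ ν)
    (hdim : Module.finrank K L = n)
    (vK : K → WithTop ℤ) (vL : L → WithTop ℤ)
    (hvK : IsDiscreteValuationOn vK) (hvL : IsDiscreteValuationOn vL)
    (hKcomplete : IsCompleteWrt vK)
    (hres : HasPerfectResidueFieldCharP vK p)
    (htotram : ∀ x : K, vL (algebraMap K L x) = n • vK x)
    (π : L) (hπ : vL π = 1)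
    (ℓ : ℕ) (hℓ : 1 ≤ ℓ)
    (r : K) (hr : (0 : WithTop ℤ) ≤ vK r)
    (πt : L) (hπt : πt = π + algebraMap K L r * π ^ (ℓ + 1))
    (h : ℕ) (hh1 : 1 ≤ h) (hhn : h ≤ n) :
    ((phiIdx vK p ν n (vL (p : L)) (minpolyCoeff K n π) (vbar p ν h) ℓ).map
        fun a : ℤ => (⌈((a : ℚ) + (h : ℚ)) / (n : ℚ)⌉ : ℤ)) ≤
      vK (minpolyCoeff K n πt h - minpolyCoeff K n π h) := by
  have hn0 : 0 < n := hdim ▸ Module.finrank_pos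
  have hπt1 : vL πt = 1 := by
    have h1 : vL π < vL (algebraMap K L r * π ^ (ℓ + 1)) := by
      have h2 : 0 ≤ vL (algebraMap K L r) := by
        rw [htotram]; exact nsmul_nonneg hr n
      have h3 := val_pow_ge hvL.toAdd π 1 (ℓ + 1) (by rw [hvL.toAdd_apply, hπ]; simp)
      rw [hvL.toAdd_apply] at h3
      rw [hvL.map_mul, hπ]
      have h4 : (1 : WithTop ℤ) < ((((ℓ + 1) * 1 : ℕ) : ℤ) : WithTop ℤ) := by
        have : (1 : ℤ) < (((ℓ + 1) * 1 : ℕ) : ℤ) := by omega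
        exact_mod_cast this
      exact h4.trans_le (h3.trans (le_add_of_nonneg_left h2))
    rw [hπt, ← hπ]
    exact hvL.toAdd.map_add_eq_of_lt_left h1
  obtain ⟨hdeg, hco⟩ := eisenstein n hdim vK vL hvK hvL htotram π hπ
  obtain ⟨hdegt, -⟩ := eisenstein n hdim vK vL hvK hvL htotram πt hπt1
  apply ceil_le n h hn0
  rw [← htotram]
  change phiIdx vK p ν n (hvL.toAdd (p : L)) (minpolyCoeff K n π) (vbar p ν h) ℓ +
    ((h : ℤ) : WithTop ℤ) ≤
      hvL.toAdd (algebraMap K L (minpolyCoeff K n πt h - minpolyCoeff K n π h))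
  obtain ⟨N, D, hD2, hD3, hdiff⟩ := diff_expansion (AlgebraicClosure K) n hdim π πt r ℓ hπt hdeg
    hdegt h hhn
  rw [hdiff, map_sum]
  apply AddValuation.map_le_sum
  intro g _
  rw [map_mul, AddValuation.map_mul]
  refine le_trans ?_ (le_add_of_nonneg_left ?_)
  · refine final_bound p ν n hp vK hvL.toAdd htotram hn0 _ ?_ ℓ h (g + 1) hh1 (by omega) _
      (hD2 _) (hD3 _)
    intro i hi1 hin
    have h1 := hco (n - i) (by omega)
    have h2 : vK (minpolyCoeff K n π i) = vK ((minpoly K π).coeff (n - i)) := by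
      rw [minpolyCoeff]
      rcases neg_one_pow_eq_or K i with h3 | h3
      · rw [h3, one_mul]
      · rw [h3, neg_one_mul]
        exact hvK.toAdd.map_neg _
    rw [h2]; exact h1
  · rw [map_pow, AddValuation.map_pow, hvL.toAdd_apply, htotram]
    exact nsmul_nonneg (nsmul_nonneg hr n) _

end
end
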